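/- arXiv:math/9801072 — 2 statements merged into one kernel-verified Lean document; each statement's English description precedes it below -/
import Mathlib

section
/- For every positive integer h with h ≡ 0 (mod 4), the constant term in the Fourier expansion at infinity of T_{2,h} is non-zero: c_0[T_{2,h}] ≠ 0. -/
open Complex Filter UpperHalfPlane
open scoped MatrixGroups ModularForm Manifold

noncomputable section

/-- `q = e^{2πiz}`. -/
def qexp (z : ℂ) : ℂ := Complex.exp (2 * Real.pi * Complex.I * z)

/-- `σ^odd(n) = Σ_{d∣n, d odd} d`. -/
def sigmaOdd (n : ℕ) : ℕ := ∑ d ∈ n.divisors.filter (fun d => Odd d), d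

/-- `σ₃^alt(n) = Σ_{d∣n} (-1)^d d³`. -/
def sigma3Alt (n : ℕ) : ℤ := ∑ d ∈ n.divisors, (-1 : ℤ) ^ d * (d : ℤ) ^ 3

/-- `σ*_{2,3}(n) = Σ_{d∣n, n/d odd} d³`. -/
def sigmaStar3 (n : ℕ) : ℕ := ∑ d ∈ n.divisors.filter (fun d => Odd (n / d)), d ^ 3

/-- `E_{γ,2} = 1 + 24 Σ σ^odd(n) qⁿ`. -/
def Egamma2 (z : ℂ) : ℂ := 1 + 24 * ∑' n : ℕ+, (sigmaOdd n : ℂ) * qexp z ^ (n : ℕ)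

/-- `E_{0,4} = 1 + 16 Σ σ₃^alt(n) qⁿ`. -/
def E04 (z : ℂ) : ℂ := 1 + 16 * ∑' n : ℕ+, (sigma3Alt n : ℂ) * qexp z ^ (n : ℕ)

/-- `E_{∞,4} = Σ σ*_{2,3}(n) qⁿ`. -/
def Einf4 (z : ℂ) : ℂ := ∑' n : ℕ+, (sigmaStar3 n : ℂ) * qexp z ^ (n : ℕ)

/-- `j₂ = E_{γ,2}² / E_{∞,4}`. -/
def j2 (z : ℂ) : ℂ := Egamma2 z ^ 2 / Einf4 z

/-- `T_{2,h}` for `h ≡ 0 (mod 4)`: with `r = h/4 + 1`,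
`T_{2,h} = E_{γ,2}·E_{0,4}·E_{∞,4}^{−r}`. -/
def T2 (h : ℕ) (z : ℂ) : ℂ :=
  if h % 4 = 0 then Egamma2 z * E04 z * (Einf4 z ^ (h / 4 + 1))⁻¹
  else Egamma2 z ^ 2 * E04 z * (Einf4 z ^ (h / 4 + 2))⁻¹

/-- The quadruples `(a, x, b, y)` of positive integers with `a * x + b * y = n`. -/
def quads (n : ℕ) : Finset (ℕ × ℕ × ℕ × ℕ) :=
  (Finset.Icc 1 n ×ˢ Finset.Icc 1 n ×ˢ Finset.Icc 1 n ×ˢ Finset.Icc 1 n).filter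
    fun t => t.1 * t.2.1 + t.2.2.1 * t.2.2.2 = n

theorem mem_quads {n a x b y : ℕ} :
    (a, x, b, y) ∈ quads n ↔ 0 < a ∧ 0 < x ∧ 0 < b ∧ 0 < y ∧ a * x + b * y = n := by
  simp only [quads, Finset.mem_filter, Finset.mem_product, Finset.mem_Icc]
  constructor
  · rintro ⟨⟨h1, h2, h3, h4⟩, h⟩
    exact ⟨h1.1, h2.1, h3.1, h4.1, h⟩
  · rintro ⟨h1, h2, h3, h4, h⟩
    refine ⟨⟨⟨h1, ?_⟩, ⟨h2, ?_⟩, ⟨h3, ?_⟩, ⟨h4, ?_⟩⟩, h⟩ <;> nlinarith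

theorem sum_quads_swap (n : ℕ) (g : ℕ → ℕ → ℕ → ℕ → ℚ) (p : ℕ → ℕ → ℕ → ℕ → Prop)
    [∀ a x b y, Decidable (p a x b y)] :
    ∑ t ∈ quads n with p t.1 t.2.1 t.2.2.1 t.2.2.2, g t.1 t.2.1 t.2.2.1 t.2.2.2 =
      ∑ t ∈ quads n with p t.2.2.1 t.2.2.2 t.1 t.2.1, g t.2.2.1 t.2.2.2 t.1 t.2.1 := by
  refine Finset.sum_nbij' (fun t => (t.2.2.1, t.2.2.2, t.1, t.2.1))
    (fun t => (t.2.2.1, t.2.2.2, t.1, t.2.1)) ?_ ?_ ?_ ?_ ?_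
  · rintro ⟨a, x, b, y⟩
    simp only [Finset.mem_filter, mem_quads]
    rintro ⟨⟨h1, h2, h3, h4, h⟩, h5⟩
    exact ⟨⟨h3, h4, h1, h2, by omega⟩, h5⟩
  · rintro ⟨a, x, b, y⟩
    simp only [Finset.mem_filter, mem_quads]
    rintro ⟨⟨h1, h2, h3, h4, h⟩, h5⟩
    exact ⟨⟨h3, h4, h1, h2, by omega⟩, h5⟩
  · simp
  · simp
  · simp

theorem sum_quads_transpose (n : ℕ) (g : ℕ → ℕ → ℕ → ℕ → ℚ) (p : ℕ → ℕ → ℕ → ℕ → Prop)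
    [∀ a x b y, Decidable (p a x b y)] :
    ∑ t ∈ quads n with p t.1 t.2.1 t.2.2.1 t.2.2.2, g t.1 t.2.1 t.2.2.1 t.2.2.2 =
      ∑ t ∈ quads n with p t.2.1 t.1 t.2.2.2 t.2.2.1, g t.2.1 t.1 t.2.2.2 t.2.2.1 := by
  refine Finset.sum_nbij' (fun t => (t.2.1, t.1, t.2.2.2, t.2.2.1))
    (fun t => (t.2.1, t.1, t.2.2.2, t.2.2.1)) ?_ ?_ ?_ ?_ ?_
  · rintro ⟨a, x, b, y⟩
    simp only [Finset.mem_filter, mem_quads]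
    rintro ⟨⟨h1, h2, h3, h4, h⟩, h5⟩
    exact ⟨⟨h2, h1, h4, h3, by rw [mul_comm x, mul_comm y]; exact h⟩, h5⟩
  · rintro ⟨a, x, b, y⟩
    simp only [Finset.mem_filter, mem_quads]
    rintro ⟨⟨h1, h2, h3, h4, h⟩, h5⟩
    exact ⟨⟨h2, h1, h4, h3, by rw [mul_comm x, mul_comm y]; exact h⟩, h5⟩
  · simp
  · simp
  · simp

/-- The bijection `(a, x, b, y) ↦ (a - b, x, b, x + y)` from `b < a` onto `x < y`. -/
theorem sum_quads_shear (n : ℕ) (g : ℕ → ℕ → ℕ → ℕ → ℚ) :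
    ∑ t ∈ quads n with t.2.2.1 < t.1, g (t.1 - t.2.2.1) t.2.1 t.2.2.1 (t.2.1 + t.2.2.2) =
      ∑ t ∈ quads n with t.2.1 < t.2.2.2, g t.1 t.2.1 t.2.2.1 t.2.2.2 := by
  refine Finset.sum_nbij' (fun t => (t.1 - t.2.2.1, t.2.1, t.2.2.1, t.2.1 + t.2.2.2))
    (fun t => (t.1 + t.2.2.1, t.2.1, t.2.2.1, t.2.2.2 - t.2.1)) ?_ ?_ ?_ ?_ ?_
  · rintro ⟨a, x, b, y⟩
    simp only [Finset.mem_filter, mem_quads]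
    rintro ⟨⟨h1, h2, h3, h4, h⟩, h5⟩
    obtain ⟨c, rfl⟩ := Nat.exists_eq_add_of_lt h5
    have : b + c + 1 - b = c + 1 := by omega
    rw [this]
    exact ⟨⟨by omega, h2, h3, by omega, by rw [← h]; ring⟩, by omega⟩
  · rintro ⟨a, x, b, y⟩
    simp only [Finset.mem_filter, mem_quads]
    rintro ⟨⟨h1, h2, h3, h4, h⟩, h5⟩
    obtain ⟨c, rfl⟩ := Nat.exists_eq_add_of_lt h5
    have : x + c + 1 - x = c + 1 := by omega
    rw [this]
    exact ⟨⟨by omega, h2, h3, by omega, by rw [← h]; ring⟩, by omega⟩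
  · rintro ⟨a, x, b, y⟩
    simp only [Finset.mem_filter, Prod.mk.injEq]
    rintro ⟨-, h⟩
    exact ⟨by omega, trivial, trivial, by omega⟩
  · rintro ⟨a, x, b, y⟩
    simp only [Finset.mem_filter, Prod.mk.injEq]
    rintro ⟨-, h⟩
    exact ⟨by omega, trivial, trivial, by omega⟩
  · simp

/-- The bijection `(a, x, b, y) ↦ (a, x + y, b - a, y)` from `a < b` onto `y < x`. -/
theorem sum_quads_shear' (n : ℕ) (g : ℕ → ℕ → ℕ → ℕ → ℚ) :
    ∑ t ∈ quads n with t.1 < t.2.2.1, g t.1 (t.2.1 + t.2.2.2) (t.2.2.1 - t.1) t.2.2.2 =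
      ∑ t ∈ quads n with t.2.2.2 < t.2.1, g t.1 t.2.1 t.2.2.1 t.2.2.2 := by
  rw [sum_quads_swap n (fun a x b y => g a (x + y) (b - a) y) fun a x b y => a < b]
  rw [sum_quads_swap n g fun a x b y => y < x]
  rw [← sum_quads_shear n fun a x b y => g b y a x]
  refine Finset.sum_congr rfl fun t _ => ?_
  rw [add_comm]

theorem sum_quads_trichotomy (n : ℕ) (u v : ℕ × ℕ × ℕ × ℕ → ℕ)
    (F : ℕ × ℕ × ℕ × ℕ → ℚ) :
    ∑ t ∈ quads n, F t = ∑ t ∈ quads n with u t < v t, F t +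
      ∑ t ∈ quads n with v t < u t, F t + ∑ t ∈ quads n with u t = v t, F t := by
  simp only [Finset.sum_filter, ← Finset.sum_add_distrib]
  refine Finset.sum_congr rfl fun t _ => ?_
  rcases lt_trichotomy (u t) (v t) with h | h | h
  · simp [h, h.ne, h.not_gt]
  · simp [h]
  · simp [h, h.ne', h.not_gt]

theorem sum_quads_diag (n : ℕ) (g : ℕ → ℕ → ℕ → ℚ) :
    ∑ t ∈ quads n with t.1 = t.2.2.1, g t.1 t.2.1 t.2.2.2 =
      ∑ p ∈ n.divisorsAntidiagonal, ∑ y ∈ Finset.Ico 1 p.2, g p.1 (p.2 - y) y := by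
  rw [Finset.sum_sigma']
  refine Finset.sum_nbij' (fun t => ⟨(t.1, t.2.1 + t.2.2.2), t.2.2.2⟩)
    (fun s => (s.1.1, s.1.2 - s.2, s.1.1, s.2)) ?_ ?_ ?_ ?_ ?_
  · rintro ⟨a, x, b, y⟩
    simp only [Finset.mem_filter, mem_quads, Finset.mem_sigma, Nat.mem_divisorsAntidiagonal,
      Finset.mem_Ico]
    rintro ⟨⟨h1, h2, h3, h4, h⟩, rfl⟩
    refine ⟨⟨by rw [← h]; ring, ?_⟩, h4, by omega⟩
    have := Nat.mul_pos h1 h2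
    omega
  · rintro ⟨⟨a, m⟩, y⟩
    simp only [Finset.mem_filter, mem_quads, Finset.mem_sigma, Nat.mem_divisorsAntidiagonal,
      Finset.mem_Ico]
    rintro ⟨⟨h, h0⟩, h1, h2⟩
    refine ⟨⟨Nat.pos_of_ne_zero fun h => by simp_all, by omega,
      Nat.pos_of_ne_zero fun h => by simp_all, h1, ?_⟩, trivial⟩
    rw [← mul_add, Nat.sub_add_cancel h2.le, h]
  · rintro ⟨a, x, b, y⟩
    simp only [Finset.mem_filter, Prod.mk.injEq]
    rintro ⟨-, rfl⟩
    simp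
  · rintro ⟨⟨a, m⟩, y⟩
    simp only [Finset.mem_sigma, Finset.mem_Ico]
    rintro ⟨-, h1, h2⟩
    simp [Nat.sub_add_cancel h2.le]
  · rintro ⟨a, x, b, y⟩
    simp

/-- A two-variable form of Liouville's elementary identity. -/
theorem liouville_identity (n : ℕ) (f : ℤ → ℤ → ℚ) (hu : ∀ u v, f (-u) v = f u v)
    (hv : ∀ u v, f u (-v) = f u v) :
    ∑ t ∈ quads n, (f ((t.1 : ℤ) - t.2.2.1) (t.2.1 + t.2.2.2) -
        f (t.1 + t.2.2.1) ((t.2.1 : ℤ) - t.2.2.2)) =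
      ∑ p ∈ n.divisorsAntidiagonal, ∑ y ∈ Finset.Ico 1 p.2, (f 0 p.2 + 2 * f p.1 y) -
      ∑ p ∈ n.divisorsAntidiagonal, ∑ a ∈ Finset.Ico 1 p.2, (f p.2 0 + 2 * f a p.1) := by
  have key₁ : ∑ t ∈ quads n, f ((t.1 : ℤ) - t.2.2.1) (t.2.1 + t.2.2.2) =
      2 * ∑ t ∈ quads n with t.2.1 < t.2.2.2, f t.1 t.2.2.2 +
        ∑ t ∈ quads n with t.1 = t.2.2.1, f 0 (t.2.1 + t.2.2.2) := by
    have h₁ : ∑ t ∈ quads n with t.2.2.1 < t.1, f ((t.1 : ℤ) - t.2.2.1) (t.2.1 + t.2.2.2) =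
        ∑ t ∈ quads n with t.2.1 < t.2.2.2, f t.1 t.2.2.2 := by
      rw [← sum_quads_shear n fun a x b y => f a y]
      refine Finset.sum_congr rfl fun t ht => ?_
      push_cast [(Finset.mem_filter.1 ht).2.le]
      rfl
    rw [sum_quads_trichotomy n (fun t => t.1) (fun t => t.2.2.1), h₁,
      sum_quads_swap n (fun a x b y => f ((a : ℤ) - b) (x + y)) fun a x b y => a < b, two_mul]
    refine congrArg₂ _ (congrArg₂ _ ?_ rfl) ?_
    · rw [← h₁]
      refine Finset.sum_congr rfl fun t _ => ?_
      rw [← hu, neg_sub, add_comm (t.2.2.2 : ℤ)]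
    · refine Finset.sum_congr rfl fun t ht => ?_
      rw [(Finset.mem_filter.1 ht).2, sub_self]
  have key₂ : ∑ t ∈ quads n, f (t.1 + t.2.2.1) ((t.2.1 : ℤ) - t.2.2.2) =
      2 * ∑ t ∈ quads n with t.2.2.1 < t.1, f t.1 t.2.2.2 +
        ∑ t ∈ quads n with t.2.1 = t.2.2.2, f (t.1 + t.2.2.1) 0 := by
    have h₁ : ∑ t ∈ quads n with t.2.1 < t.2.2.2, f (t.1 + t.2.2.1) ((t.2.1 : ℤ) - t.2.2.2) =
        ∑ t ∈ quads n with t.2.2.1 < t.1, f t.1 t.2.2.2 := by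
      rw [← sum_quads_shear n fun a x b y => f (a + b) ((x : ℤ) - y)]
      refine Finset.sum_congr rfl fun t ht => ?_
      push_cast [(Finset.mem_filter.1 ht).2.le]
      rw [← hv]
      congr 1 <;> ring
    rw [sum_quads_trichotomy n (fun t => t.2.1) (fun t => t.2.2.2), h₁,
      sum_quads_swap n (fun a x b y => f (a + b) ((x : ℤ) - y)) fun a x b y => y < x, two_mul]
    refine congrArg₂ _ (congrArg₂ _ rfl ?_) ?_
    · rw [← h₁]
      refine Finset.sum_congr rfl fun t _ => ?_
      rw [← hv, neg_sub, add_comm (t.2.2.1 : ℤ)]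
    · refine Finset.sum_congr rfl fun t ht => ?_
      rw [(Finset.mem_filter.1 ht).2, sub_self]
  have key₃ : ∑ t ∈ quads n with t.1 < t.2.2.1, f t.1 t.2.2.2 =
      ∑ t ∈ quads n with t.2.2.2 < t.2.1, f t.1 t.2.2.2 :=
    sum_quads_shear' n fun a x b y => f a y
  have s₁ := sum_quads_trichotomy n (fun t => t.1) (fun t => t.2.2.1)
    (fun t => f t.1 t.2.2.2)
  have s₂ := sum_quads_trichotomy n (fun t => t.2.1) (fun t => t.2.2.2)
    (fun t => f t.1 t.2.2.2)
  have d₁ : ∑ t ∈ quads n with t.1 = t.2.2.1, (f 0 (t.2.1 + t.2.2.2) + 2 * f t.1 t.2.2.2) =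
      ∑ p ∈ n.divisorsAntidiagonal, ∑ y ∈ Finset.Ico 1 p.2, (f 0 p.2 + 2 * f p.1 y) := by
    rw [sum_quads_diag n fun a x y => f 0 (x + y) + 2 * f a y]
    refine Finset.sum_congr rfl fun p _ => Finset.sum_congr rfl fun y hy => ?_
    push_cast [(Finset.mem_Ico.1 hy).2.le]
    rw [sub_add_cancel]
  have d₂ : ∑ t ∈ quads n with t.2.1 = t.2.2.2, (f (t.1 + t.2.2.1) 0 + 2 * f t.1 t.2.2.2) =
      ∑ p ∈ n.divisorsAntidiagonal, ∑ a ∈ Finset.Ico 1 p.2, (f p.2 0 + 2 * f a p.1) := by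
    have h : ∑ t ∈ quads n with t.2.1 = t.2.2.2, (f (t.1 + t.2.2.1) 0 + 2 * f t.1 t.2.2.2) =
        ∑ t ∈ quads n with t.2.1 = t.2.2.2, (f (t.1 + t.2.2.1) 0 + 2 * f t.2.2.1 t.2.1) := by
      rw [sum_quads_swap n (fun a x b y => f (a + b) 0 + 2 * f a y) fun a x b y => x = y]
      simp only [eq_comm, add_comm]
    rw [h, sum_quads_transpose n (fun a x b y => f (a + b) 0 + 2 * f b x) fun a x b y => x = y,
      sum_quads_diag n fun a x y => f (x + y) 0 + 2 * f y a]
    refine Finset.sum_congr rfl fun p _ => Finset.sum_congr rfl fun y hy => ?_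
    push_cast [(Finset.mem_Ico.1 hy).2.le]
    rw [sub_add_cancel]
  rw [Finset.sum_add_distrib, ← Finset.mul_sum] at d₁ d₂
  rw [Finset.sum_sub_distrib, key₁, key₂]
  linarith

/-- The power series `∑ₙ (∑_{a x = n} F a x) Xⁿ`. -/
def divSeries (F : ℕ → ℕ → ℚ) : PowerSeries ℚ :=
  PowerSeries.mk fun n => ∑ p ∈ n.divisorsAntidiagonal, F p.1 p.2

theorem coeff_divSeries (F : ℕ → ℕ → ℚ) (n : ℕ) :
    PowerSeries.coeff n (divSeries F) = ∑ p ∈ n.divisorsAntidiagonal, F p.1 p.2 :=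
  PowerSeries.coeff_mk _ _

theorem coeff_divSeries_mul (F G : ℕ → ℕ → ℚ) (n : ℕ) :
    PowerSeries.coeff n (divSeries F * divSeries G) =
      ∑ t ∈ quads n, F t.1 t.2.1 * G t.2.2.1 t.2.2.2 := by
  simp only [PowerSeries.coeff_mul, coeff_divSeries, Finset.sum_mul_sum, ← Finset.sum_product']
  rw [Finset.sum_sigma']
  refine Finset.sum_nbij' (fun s => (s.2.1.1, s.2.1.2, s.2.2.1, s.2.2.2))
    (fun t => ⟨(t.1 * t.2.1, t.2.2.1 * t.2.2.2), ((t.1, t.2.1), (t.2.2.1, t.2.2.2))⟩)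
    ?_ ?_ ?_ ?_ ?_
  · rintro ⟨⟨i, j⟩, ⟨a, x⟩, b, y⟩
    simp only [Finset.mem_sigma, Finset.mem_product, Nat.mem_divisorsAntidiagonal, mem_quads]
    rintro ⟨h, ⟨rfl, h₁⟩, rfl, h₂⟩
    simp only [ne_eq, mul_eq_zero, not_or, ← Nat.pos_iff_ne_zero] at h₁ h₂
    exact ⟨h₁.1, h₁.2, h₂.1, h₂.2, Finset.HasAntidiagonal.mem_antidiagonal.1 h⟩
  · rintro ⟨a, x, b, y⟩
    simp only [Finset.mem_sigma, Finset.mem_product, Nat.mem_divisorsAntidiagonal, mem_quads]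
    rintro ⟨h₁, h₂, h₃, h₄, h⟩
    exact ⟨Finset.HasAntidiagonal.mem_antidiagonal.2 h, ⟨trivial, (Nat.mul_pos h₁ h₂).ne'⟩, trivial,
      (Nat.mul_pos h₃ h₄).ne'⟩
  · rintro ⟨⟨i, j⟩, ⟨a, x⟩, b, y⟩
    simp only [Finset.mem_sigma, Finset.mem_product, Nat.mem_divisorsAntidiagonal]
    rintro ⟨h, ⟨rfl, h₁⟩, rfl, h₂⟩
    rfl
  · rintro ⟨a, x, b, y⟩ _
    rfl
  · rintro ⟨⟨i, j⟩, ⟨a, x⟩, b, y⟩ _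
    rfl

theorem sum_divisorsAntidiagonal_swap (n : ℕ) (F : ℕ → ℕ → ℚ) :
    ∑ p ∈ n.divisorsAntidiagonal, F p.1 p.2 = ∑ p ∈ n.divisorsAntidiagonal, F p.2 p.1 := by
  rw [← Nat.map_swap_divisorsAntidiagonal, Finset.sum_map]
  simp

/-- The substitution `X ↦ X²`. -/
def dilate : PowerSeries ℚ →ₐ[ℚ] PowerSeries ℚ := PowerSeries.expand 2 two_ne_zero

theorem divSeries_dilate_left (F : ℕ → ℕ → ℚ) :
    dilate (divSeries fun a x => F (2 * a) x) =
      divSeries fun a x => if Even a then F a x else 0 := by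
  ext n
  rw [dilate, PowerSeries.coeff_expand, coeff_divSeries, coeff_divSeries, ← Finset.sum_filter]
  split_ifs with h
  · obtain ⟨m, rfl⟩ := h
    rw [Nat.mul_div_cancel_left m two_pos]
    refine Finset.sum_nbij' (fun p => (2 * p.1, p.2)) (fun p => (p.1 / 2, p.2)) ?_ ?_ ?_ ?_ ?_
    · rintro ⟨a, x⟩
      simp only [Nat.mem_divisorsAntidiagonal, Finset.mem_filter]
      rintro ⟨rfl, h⟩
      exact ⟨⟨by ring, by omega⟩, even_two_mul a⟩
    · rintro ⟨a, x⟩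
      simp only [Nat.mem_divisorsAntidiagonal, Finset.mem_filter]
      rintro ⟨⟨h, h0⟩, h1⟩
      obtain ⟨b, rfl⟩ := h1.two_dvd
      rw [Nat.mul_div_cancel_left b two_pos]
      exact ⟨by linarith [mul_assoc 2 b x], by omega⟩
    · simp
    · rintro ⟨a, x⟩
      simp only [Finset.mem_filter]
      rintro ⟨-, h1⟩
      rw [Nat.mul_div_cancel' h1.two_dvd]
    · simp
  · symm
    rw [Finset.sum_eq_zero]
    rintro ⟨a, x⟩
    simp only [Nat.mem_divisorsAntidiagonal, Finset.mem_filter]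
    rintro ⟨⟨rfl, -⟩, h1⟩
    exact absurd (h1.two_dvd.mul_right x) h

theorem divSeries_swap (F : ℕ → ℕ → ℚ) : divSeries (fun a x => F x a) = divSeries F := by
  ext n
  rw [coeff_divSeries, coeff_divSeries, sum_divisorsAntidiagonal_swap]

theorem divSeries_dilate_right (F : ℕ → ℕ → ℚ) :
    dilate (divSeries fun a x => F a (2 * x)) =
      divSeries fun a x => if Even x then F a x else 0 := by
  rw [← divSeries_swap, divSeries_dilate_left (fun a x => F x a), ← divSeries_swap]

/-- The Lambert series `∑ₙ σₖ(n) Xⁿ`. -/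
def sigmaSeries (k : ℕ) : PowerSeries ℚ := divSeries fun a _ => (a : ℚ) ^ k

theorem divSeries_sign_left (k : ℕ) :
    divSeries (fun a _ => (-1) ^ a * (a : ℚ) ^ k) =
      2 ^ (k + 1) * dilate (sigmaSeries k) - sigmaSeries k := by
  have h : dilate (divSeries fun a _ => ((2 * a : ℕ) : ℚ) ^ k) = 2 ^ k * dilate (sigmaSeries k) := by
    rw [← map_ofNat dilate 2, ← map_pow, ← map_mul]
    congr 1
    ext n
    rw [← map_ofNat (PowerSeries.C (R := ℚ)) 2, ← map_pow, PowerSeries.coeff_C_mul, sigmaSeries,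
      coeff_divSeries, coeff_divSeries, Finset.mul_sum]
    refine Finset.sum_congr rfl fun p _ => ?_
    push_cast
    ring
  rw [pow_succ', mul_assoc, ← h, divSeries_dilate_left fun a _ => (a : ℚ) ^ k, two_mul]
  ext n
  simp only [map_sub, map_add, sigmaSeries, coeff_divSeries, ← Finset.sum_add_distrib,
    ← Finset.sum_sub_distrib]
  refine Finset.sum_congr rfl fun p _ => ?_
  split_ifs with h
  · rw [h.neg_one_pow]; ring
  · rw [(Nat.not_even_iff_odd.1 h).neg_one_pow]; ring

theorem divSeries_sign_right (k : ℕ) :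
    divSeries (fun a x => (-1) ^ x * (a : ℚ) ^ k) =
      2 * dilate (sigmaSeries k) - sigmaSeries k := by
  rw [sigmaSeries, divSeries_dilate_right fun a _ => (a : ℚ) ^ k, two_mul]
  ext n
  simp only [map_sub, map_add, coeff_divSeries, ← Finset.sum_add_distrib,
    ← Finset.sum_sub_distrib]
  refine Finset.sum_congr rfl fun p _ => ?_
  split_ifs with h
  · rw [h.neg_one_pow]; ring
  · rw [(Nat.not_even_iff_odd.1 h).neg_one_pow]; ring

/-- The derivation `X d/dX`. -/
def eulerD : Derivation ℚ (PowerSeries ℚ) (PowerSeries ℚ) :=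
  (PowerSeries.X : PowerSeries ℚ) • PowerSeries.derivative ℚ

theorem coeff_eulerD (f : PowerSeries ℚ) (n : ℕ) :
    PowerSeries.coeff n (eulerD f) = n * PowerSeries.coeff n f := by
  cases n with
  | zero => simp [eulerD]
  | succ n => simp [eulerD, PowerSeries.coeff_succ_X_mul, PowerSeries.coeff_derivative, mul_comm]

theorem eulerD_dilate (f : PowerSeries ℚ) : eulerD (dilate f) = 2 * dilate (eulerD f) := by
  ext n
  rw [← map_ofNat (PowerSeries.C (R := ℚ)) 2, PowerSeries.coeff_C_mul, coeff_eulerD, dilate,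
    PowerSeries.coeff_expand, PowerSeries.coeff_expand, coeff_eulerD]
  split_ifs with h
  · obtain ⟨m, rfl⟩ := h
    rw [Nat.mul_div_cancel_left m two_pos]
    push_cast
    ring
  · simp

theorem sum_Ico_pow_four {m : ℕ} (hm : 1 ≤ m) :
    ∑ a ∈ Finset.Ico 1 m, (a : ℚ) ^ 4 = m ^ 5 / 5 - m ^ 4 / 2 + m ^ 3 / 3 - m / 30 := by
  induction m, hm using Nat.le_induction with
  | base => norm_num
  | succ m hm ih => rw [Finset.sum_Ico_succ_top hm, ih]; push_cast; ring

theorem sum_Ico_sign_mul_pow_four {m : ℕ} (hm : 1 ≤ m) :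
    ∑ a ∈ Finset.Ico 1 m, (-1 : ℚ) ^ a * (a : ℚ) ^ 4 =
      -((-1) ^ m / 2) * (m ^ 4 - 2 * m ^ 3 + m) := by
  induction m, hm using Nat.le_induction with
  | base => norm_num
  | succ m hm ih => rw [Finset.sum_Ico_succ_top hm, ih]; push_cast; ring

theorem sum_Ico_sign {m : ℕ} (hm : 1 ≤ m) :
    ∑ a ∈ Finset.Ico 1 m, (-1 : ℚ) ^ a = -(1 + (-1) ^ m) / 2 := by
  induction m, hm using Nat.le_induction with
  | base => norm_num
  | succ m hm ih => rw [Finset.sum_Ico_succ_top hm, ih]; ring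

theorem neg_one_zpow_neg (u : ℤ) : (-1 : ℚ) ^ (-u) = (-1) ^ u := by
  rw [zpow_neg, ← inv_zpow, inv_neg_one]

/-- The Liouville identity for `f u v = u⁴ χ u v`. -/
theorem liouville_pow_four (n : ℕ) (χ : ℤ → ℤ → ℚ) (hu : ∀ u v, χ (-u) v = χ u v)
    (hv : ∀ u v, χ u (-v) = χ u v) :
    ∑ t ∈ quads n, (((t.1 : ℚ) - t.2.2.1) ^ 4 * χ ((t.1 : ℤ) - t.2.2.1) (t.2.1 + t.2.2.2) -
        ((t.1 : ℚ) + t.2.2.1) ^ 4 * χ (t.1 + t.2.2.1) ((t.2.1 : ℤ) - t.2.2.2)) =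
      ∑ p ∈ n.divisorsAntidiagonal, (2 * (p.1 : ℚ) ^ 4 * ∑ y ∈ Finset.Ico 1 p.2, χ p.1 y -
        (((p.1 : ℚ) - 1) * p.1 ^ 4 * χ p.1 0 +
          2 * ∑ a ∈ Finset.Ico 1 p.1, (a : ℚ) ^ 4 * χ a p.2)) := by
  have h := liouville_identity n (fun u v => (u : ℚ) ^ 4 * χ u v)
    (fun u v => by push_cast; rw [hu]; ring) fun u v => by rw [hv]
  push_cast at h
  rw [h, sum_divisorsAntidiagonal_swap n fun x m =>
    ∑ a ∈ Finset.Ico 1 m, ((m : ℚ) ^ 4 * χ m 0 + 2 * ((a : ℚ) ^ 4 * χ a x)),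
    ← Finset.sum_sub_distrib]
  refine Finset.sum_congr rfl fun p hp => ?_
  have hp' := Nat.mem_divisorsAntidiagonal.1 hp
  have h1 : 1 ≤ p.1 := Nat.pos_of_ne_zero fun h => hp'.2 (by rw [← hp'.1, h, zero_mul])
  simp only [Finset.sum_add_distrib, Finset.mul_sum, Finset.sum_const, Nat.card_Ico, nsmul_eq_mul]
  push_cast [h1]
  simp only [mul_assoc]
  ring

theorem one_le_of_mem_divisorsAntidiagonal {n : ℕ} {p : ℕ × ℕ}
    (hp : p ∈ n.divisorsAntidiagonal) : 1 ≤ p.1 ∧ 1 ≤ p.2 := by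
  obtain ⟨h, h0⟩ := Nat.mem_divisorsAntidiagonal.1 hp
  rw [← h, mul_ne_zero_iff] at h0
  exact ⟨Nat.pos_of_ne_zero h0.1, Nat.pos_of_ne_zero h0.2⟩

theorem coeff_divSeries_mul_comm (F G : ℕ → ℕ → ℚ) (n : ℕ) :
    2 * PowerSeries.coeff n (divSeries F * divSeries G) =
      ∑ t ∈ quads n, (F t.1 t.2.1 * G t.2.2.1 t.2.2.2 + G t.1 t.2.1 * F t.2.2.1 t.2.2.2) := by
  rw [Finset.sum_add_distrib, ← coeff_divSeries_mul, ← coeff_divSeries_mul,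
    mul_comm (divSeries G), two_mul]

theorem coeff_ofNat_mul (k : ℕ) [k.AtLeastTwo] (f : PowerSeries ℚ) (n : ℕ) :
    PowerSeries.coeff n (ofNat(k) * f) = ofNat(k) * PowerSeries.coeff n f := by
  rw [← map_ofNat (PowerSeries.C (R := ℚ)) k, PowerSeries.coeff_C_mul]

theorem sigmaSeries_conv :
    240 * (sigmaSeries 3 * sigmaSeries 1) =
      21 * sigmaSeries 5 + 10 * sigmaSeries 3 - sigmaSeries 1 - 30 * eulerD (sigmaSeries 3) := by
  ext n
  have h := liouville_pow_four n (fun _ _ => 1) (fun _ _ => rfl) fun _ _ => rfl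
  have hl : ∑ t ∈ quads n, (((t.1 : ℚ) - t.2.2.1) ^ 4 * 1 - ((t.1 : ℚ) + t.2.2.1) ^ 4 * 1) =
      -16 * PowerSeries.coeff n (sigmaSeries 3 * sigmaSeries 1) := by
    rw [show (-16 : ℚ) = -8 * 2 by norm_num, mul_assoc, sigmaSeries, sigmaSeries,
      coeff_divSeries_mul_comm, Finset.mul_sum]
    exact Finset.sum_congr rfl fun t _ => by ring
  rw [hl] at h
  simp only [map_sub, map_add, coeff_ofNat_mul, coeff_eulerD]
  rw [show (240 : ℚ) = -15 * -16 by norm_num, mul_assoc, h]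
  simp only [sigmaSeries, coeff_divSeries, Finset.mul_sum, ← Finset.sum_sub_distrib,
    ← Finset.sum_add_distrib]
  refine Finset.sum_congr rfl fun p hp => ?_
  obtain ⟨h1, h2⟩ := one_le_of_mem_divisorsAntidiagonal hp
  simp only [mul_one, ← Finset.mul_sum, Finset.sum_const, Nat.card_Ico, nsmul_eq_mul]
  rw [sum_Ico_pow_four h1, ← (Nat.mem_divisorsAntidiagonal.1 hp).1]
  push_cast [h1, h2]
  ring

theorem sigmaSeries_conv_sign_left :
    16 * ((16 * dilate (sigmaSeries 3) - sigmaSeries 3) *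
        (4 * dilate (sigmaSeries 1) - sigmaSeries 1)) =
      (64 * dilate (sigmaSeries 5) - sigmaSeries 5) +
        2 * (16 * dilate (sigmaSeries 3) - sigmaSeries 3) -
        (4 * dilate (sigmaSeries 1) - sigmaSeries 1) -
        2 * eulerD (16 * dilate (sigmaSeries 3) - sigmaSeries 3) := by
  have e1 := divSeries_sign_left 1
  have e3 := divSeries_sign_left 3
  have e5 := divSeries_sign_left 5
  norm_num only at e1 e3 e5
  rw [← e1, ← e3, ← e5]
  ext n
  have h := liouville_pow_four n (fun u _ => (-1) ^ u) (fun u _ => neg_one_zpow_neg u)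
    fun _ _ => rfl
  have hl : ∑ t ∈ quads n, (((t.1 : ℚ) - t.2.2.1) ^ 4 * (-1 : ℚ) ^ ((t.1 : ℤ) - t.2.2.1) -
        ((t.1 : ℚ) + t.2.2.1) ^ 4 * (-1 : ℚ) ^ ((t.1 : ℤ) + t.2.2.1)) =
      -16 * PowerSeries.coeff n ((divSeries fun a _ => (-1) ^ a * (a : ℚ) ^ 3) *
        divSeries fun a _ => (-1) ^ a * (a : ℚ) ^ 1) := by
    rw [show (-16 : ℚ) = -8 * 2 by norm_num, mul_assoc, coeff_divSeries_mul_comm, Finset.mul_sum]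
    refine Finset.sum_congr rfl fun t _ => ?_
    rw [sub_eq_add_neg (t.1 : ℤ), zpow_add₀ (by norm_num), zpow_add₀ (by norm_num),
      neg_one_zpow_neg, zpow_natCast, zpow_natCast]
    ring
  rw [hl] at h
  simp only [map_sub, map_add, coeff_ofNat_mul, coeff_eulerD]
  rw [show (16 : ℚ) = -1 * -16 by norm_num, mul_assoc, h]
  simp only [coeff_divSeries, Finset.mul_sum, ← Finset.sum_sub_distrib, ← Finset.sum_add_distrib]
  refine Finset.sum_congr rfl fun p hp => ?_
  obtain ⟨h1, h2⟩ := one_le_of_mem_divisorsAntidiagonal hp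
  simp only [zpow_natCast, ← Finset.mul_sum, Finset.sum_const, Nat.card_Ico, nsmul_eq_mul]
  simp only [mul_comm _ ((-1 : ℚ) ^ _)]
  rw [sum_Ico_sign_mul_pow_four h1, ← (Nat.mem_divisorsAntidiagonal.1 hp).1]
  push_cast [h1, h2]
  ring

theorem sigmaSeries_conv_sign_right :
    240 * ((2 * dilate (sigmaSeries 3) - sigmaSeries 3) *
        (2 * dilate (sigmaSeries 1) - sigmaSeries 1)) =
      15 * sigmaSeries 5 + 6 * (2 * dilate (sigmaSeries 5) - sigmaSeries 5) +
        10 * (2 * dilate (sigmaSeries 3) - sigmaSeries 3) -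
        (2 * dilate (sigmaSeries 1) - sigmaSeries 1) := by
  rw [← divSeries_sign_right, ← divSeries_sign_right, ← divSeries_sign_right]
  ext n
  have h := liouville_pow_four n (fun _ v => (-1) ^ v) (fun _ _ => rfl)
    fun _ v => neg_one_zpow_neg v
  have hl : ∑ t ∈ quads n, (((t.1 : ℚ) - t.2.2.1) ^ 4 * (-1 : ℚ) ^ ((t.2.1 : ℤ) + t.2.2.2) -
        ((t.1 : ℚ) + t.2.2.1) ^ 4 * (-1 : ℚ) ^ ((t.2.1 : ℤ) - t.2.2.2)) =
      -16 * PowerSeries.coeff n ((divSeries fun a x => (-1) ^ x * (a : ℚ) ^ 3) *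
        divSeries fun a x => (-1) ^ x * (a : ℚ) ^ 1) := by
    rw [show (-16 : ℚ) = -8 * 2 by norm_num, mul_assoc, coeff_divSeries_mul_comm, Finset.mul_sum]
    refine Finset.sum_congr rfl fun t _ => ?_
    rw [sub_eq_add_neg (t.2.1 : ℤ), zpow_add₀ (by norm_num), zpow_add₀ (by norm_num),
      neg_one_zpow_neg, zpow_natCast, zpow_natCast]
    ring
  rw [hl] at h
  simp only [map_sub, map_add, coeff_ofNat_mul]
  rw [show (240 : ℚ) = -15 * -16 by norm_num, mul_assoc, h]
  simp only [sigmaSeries, coeff_divSeries, Finset.mul_sum, ← Finset.sum_sub_distrib,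
    ← Finset.sum_add_distrib]
  refine Finset.sum_congr rfl fun p hp => ?_
  obtain ⟨h1, h2⟩ := one_le_of_mem_divisorsAntidiagonal hp
  simp only [zpow_natCast, zpow_zero, ← Finset.mul_sum, ← Finset.sum_mul]
  rw [sum_Ico_pow_four h1, sum_Ico_sign h2]
  ring

theorem dilate_conv :
    240 * (dilate (sigmaSeries 3) * dilate (sigmaSeries 1)) =
      21 * dilate (sigmaSeries 5) + 10 * dilate (sigmaSeries 3) - dilate (sigmaSeries 1) -
        15 * eulerD (dilate (sigmaSeries 3)) := by
  have h := congrArg dilate sigmaSeries_conv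
  simp only [map_mul, map_add, map_sub, map_ofNat] at h
  rw [h, eulerD_dilate]
  ring

theorem eulerD_sixteen : eulerD 16 = 0 := eulerD.map_natCast 16

/-- The logarithmic derivative of `E_{∞,4}`. -/
theorem eulerD_Einf :
    eulerD (sigmaSeries 3 - dilate (sigmaSeries 3)) =
      (sigmaSeries 3 - dilate (sigmaSeries 3)) *
        (1 + 8 * (sigmaSeries 1 - 4 * dilate (sigmaSeries 1))) := by
  have h1 := sigmaSeries_conv
  have h2 := sigmaSeries_conv_sign_left
  have h3 := sigmaSeries_conv_sign_right
  have h4 := dilate_conv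
  simp only [map_sub, Derivation.leibniz, eulerD_sixteen, smul_eq_mul] at h2 ⊢
  have h0 : (120 : PowerSeries ℚ) ≠ 0 := by
    rw [← map_ofNat (PowerSeries.C (R := ℚ)), map_ne_zero_iff _ PowerSeries.C_injective]
    norm_num
  refine mul_left_cancel₀ h0 ?_
  linear_combination 15 * h2 - 10 * h3 + 5 * h1 - 40 * h4

/-- The logarithmic derivative of `E_{0,4}`. -/
theorem eulerD_E0 :
    eulerD (1 + 16 * (16 * dilate (sigmaSeries 3) - sigmaSeries 3)) =
      -16 * (1 + 16 * (16 * dilate (sigmaSeries 3) - sigmaSeries 3)) *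
        (sigmaSeries 1 - dilate (sigmaSeries 1)) := by
  have h1 := sigmaSeries_conv
  have h2 := sigmaSeries_conv_sign_left
  have h3 := sigmaSeries_conv_sign_right
  have h4 := dilate_conv
  simp only [map_sub, map_add, Derivation.map_one_eq_zero, Derivation.leibniz, eulerD_sixteen,
    smul_eq_mul] at h2 ⊢
  have h0 : (60 : PowerSeries ℚ) ≠ 0 := by
    rw [← map_ofNat (PowerSeries.C (R := ℚ)), map_ne_zero_iff _ PowerSeries.C_injective]
    norm_num
  refine mul_left_cancel₀ h0 ?_
  linear_combination 16 * (-75 * h2 + 8 * h3 - 7 * h1 + 224 * h4)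

/-- The coefficients of `f(-X)` are non-negative. -/
def AltNonneg (f : PowerSeries ℚ) : Prop := ∀ n, 0 ≤ (-1) ^ n * PowerSeries.coeff n f

theorem coeff_mul_alt (f g : PowerSeries ℚ) (n : ℕ) :
    (-1) ^ n * PowerSeries.coeff n (f * g) = ∑ p ∈ Finset.HasAntidiagonal.antidiagonal n,
      ((-1) ^ p.1 * PowerSeries.coeff p.1 f) * ((-1) ^ p.2 * PowerSeries.coeff p.2 g) := by
  rw [PowerSeries.coeff_mul, Finset.mul_sum]
  refine Finset.sum_congr rfl fun p hp => ?_
  rw [← Finset.HasAntidiagonal.mem_antidiagonal.1 hp, pow_add]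
  ring

theorem AltNonneg.mul {f g : PowerSeries ℚ} (hf : AltNonneg f) (hg : AltNonneg g) :
    AltNonneg (f * g) := fun n => by
  rw [coeff_mul_alt]
  exact Finset.sum_nonneg fun p _ => mul_nonneg (hf _) (hg _)

theorem AltNonneg.pow {f : PowerSeries ℚ} (hf : AltNonneg f) (r : ℕ) : AltNonneg (f ^ r) := by
  induction r with
  | zero =>
    intro n
    rw [pow_zero, PowerSeries.coeff_one]
    split_ifs with h <;> simp [h]
  | succ r ih => rw [pow_succ]; exact ih.mul hf

theorem AltNonneg.of_eulerD_eq_mul {f g : PowerSeries ℚ} (hg : AltNonneg g)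
    (hg0 : PowerSeries.coeff 0 g = 0) (hf0 : 0 ≤ PowerSeries.coeff 0 f)
    (h : eulerD f = f * g) : AltNonneg f := by
  intro n
  induction n using Nat.strong_induction_on with
  | _ n ih =>
    rcases n.eq_zero_or_pos with rfl | hn
    · simpa using hf0
    have h1 : (n : ℚ) * ((-1) ^ n * PowerSeries.coeff n f) =
        (-1) ^ n * PowerSeries.coeff n (f * g) := by rw [← h, coeff_eulerD]; ring
    have h2 : 0 ≤ (n : ℚ) * ((-1) ^ n * PowerSeries.coeff n f) := by
      rw [h1, coeff_mul_alt]
      refine Finset.sum_nonneg fun p hp => ?_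
      have hp' := Finset.HasAntidiagonal.mem_antidiagonal.1 hp
      rcases p.2.eq_zero_or_pos with h0 | h0
      · simp [h0, hg0]
      · exact mul_nonneg (ih _ (by omega)) (hg _)
    exact nonneg_of_mul_nonneg_right h2 (by exact_mod_cast hn)

theorem alt_sum_divisors_pos {n k : ℕ} (hn : n ≠ 0) (hk : k ≠ 0) :
    0 < (-1 : ℚ) ^ n * ∑ p ∈ n.divisorsAntidiagonal, (-1) ^ p.1 * (p.1 : ℚ) ^ k := by
  rw [Nat.sum_divisorsAntidiagonal fun a _ => (-1 : ℚ) ^ a * (a : ℚ) ^ k]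
  rcases n.even_or_odd with he | ho
  · rw [he.neg_one_pow, one_mul, ← Finset.sum_filter_add_sum_filter_not n.divisors Odd]
    have h1 : ∑ d ∈ n.divisors with Odd d, (2 * (d : ℚ)) ^ k ≤
        ∑ d ∈ n.divisors with ¬ Odd d, (-1 : ℚ) ^ d * (d : ℚ) ^ k := by
      have : ∑ d ∈ n.divisors with Odd d, (2 * (d : ℚ)) ^ k =
          ∑ e ∈ (n.divisors.filter Odd).image (fun d : ℕ => 2 * d), (e : ℚ) ^ k := by
        rw [Finset.sum_image fun _ _ _ _ h => Nat.eq_of_mul_eq_mul_left two_pos h]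
        push_cast
        rfl
      rw [this]
      have h2 : ∑ d ∈ n.divisors with ¬ Odd d, (-1 : ℚ) ^ d * (d : ℚ) ^ k =
          ∑ d ∈ n.divisors with ¬ Odd d, (d : ℚ) ^ k := by
        refine Finset.sum_congr rfl fun d hd => ?_
        rw [(Nat.not_odd_iff_even.1 (Finset.mem_filter.1 hd).2).neg_one_pow, one_mul]
      rw [h2]
      refine Finset.sum_le_sum_of_subset_of_nonneg ?_ fun _ _ _ => by positivity
      intro d hd
      simp only [Finset.mem_image, Finset.mem_filter, Nat.mem_divisors] at hd ⊢
      obtain ⟨e, ⟨⟨h3, -⟩, h4⟩, rfl⟩ := hd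
      refine ⟨⟨?_, hn⟩, by simp⟩
      exact Nat.Coprime.mul_dvd_of_dvd_of_dvd (Nat.coprime_two_left.2 h4) he.two_dvd h3
    have h3 : 0 < ∑ d ∈ n.divisors with Odd d, ((-1 : ℚ) ^ d * (d : ℚ) ^ k + (2 * (d : ℚ)) ^ k) := by
      refine Finset.sum_pos (fun d hd => ?_) ⟨1, by simp [hn]⟩
      have hd' := Finset.mem_filter.1 hd
      have hd0 : (0 : ℚ) < d := by exact_mod_cast hd'.2.pos
      rw [hd'.2.neg_one_pow, neg_one_mul, neg_add_eq_sub, sub_pos]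
      exact pow_lt_pow_left₀ (by linarith) hd0.le hk
    rw [Finset.sum_add_distrib] at h3
    linarith
  · rw [Finset.mul_sum]
    refine Finset.sum_pos (fun d hd => ?_) ⟨1, by simp [hn]⟩
    have hd' := Nat.mem_divisors.1 hd
    have hd0 : 0 < d := Nat.pos_of_mem_divisors hd
    rw [ho.neg_one_pow, (ho.of_dvd_nat hd'.1).neg_one_pow]
    have : (0 : ℚ) < (d : ℚ) ^ k := by positivity
    linarith

/-- The `q`-expansion of `E_{γ,2}`. -/
def gammaSeries : PowerSeries ℚ := 1 + 24 * (sigmaSeries 1 - 2 * dilate (sigmaSeries 1))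

/-- The `q`-expansion of `E_{0,4}`. -/
def zeroSeries : PowerSeries ℚ := 1 + 16 * (16 * dilate (sigmaSeries 3) - sigmaSeries 3)

/-- The `q`-expansion of `E_{∞,4}`. -/
def inftySeries : PowerSeries ℚ := sigmaSeries 3 - dilate (sigmaSeries 3)

/-- The `q`-expansion of `E_{∞,4} / q`. -/
def inftyShift : PowerSeries ℚ := PowerSeries.mk fun n => PowerSeries.coeff (n + 1) inftySeries

theorem coeff_zero_sigmaSeries (k : ℕ) : PowerSeries.coeff 0 (sigmaSeries k) = 0 := by
  simp [sigmaSeries, coeff_divSeries]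

theorem coeff_zero_dilate (f : PowerSeries ℚ) :
    PowerSeries.coeff 0 (dilate f) = PowerSeries.coeff 0 f := by
  simp [dilate, PowerSeries.coeff_expand]

theorem X_mul_inftyShift : PowerSeries.X * inftyShift = inftySeries := by
  ext n
  cases n with
  | zero =>
    rw [PowerSeries.coeff_zero_X_mul, inftySeries, map_sub, coeff_zero_dilate, sub_self]
  | succ n => rw [PowerSeries.coeff_succ_X_mul, inftyShift, PowerSeries.coeff_mk]

theorem coeff_zero_inftyShift : PowerSeries.coeff 0 inftyShift = 1 := by
  simp [inftyShift, inftySeries, dilate, PowerSeries.coeff_expand, sigmaSeries, coeff_divSeries]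

theorem coeff_zero_gammaSeries : PowerSeries.coeff 0 gammaSeries = 1 := by
  simp only [gammaSeries, map_add, map_sub, coeff_ofNat_mul, coeff_zero_sigmaSeries,
    coeff_zero_dilate, PowerSeries.coeff_zero_one]
  norm_num

theorem coeff_zero_zeroSeries : PowerSeries.coeff 0 zeroSeries = 1 := by
  simp only [zeroSeries, map_add, map_sub, coeff_ofNat_mul, coeff_zero_sigmaSeries,
    coeff_zero_dilate, PowerSeries.coeff_zero_one]
  norm_num

theorem eulerD_X : eulerD PowerSeries.X = PowerSeries.X := by
  simp [eulerD]

theorem eulerD_inftyShift :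
    eulerD inftyShift = inftyShift * (8 * (sigmaSeries 1 - 4 * dilate (sigmaSeries 1))) := by
  have h : eulerD inftySeries =
      inftySeries * (1 + 8 * (sigmaSeries 1 - 4 * dilate (sigmaSeries 1))) := eulerD_Einf
  rw [← X_mul_inftyShift, Derivation.leibniz, eulerD_X, smul_eq_mul, smul_eq_mul] at h
  refine mul_left_cancel₀ PowerSeries.X_ne_zero ?_
  linear_combination h

theorem inftyShift_mul_inv : inftyShift * inftyShift⁻¹ = 1 :=
  PowerSeries.mul_inv_cancel _ (by
    rw [← PowerSeries.coeff_zero_eq_constantCoeff_apply, coeff_zero_inftyShift]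
    exact one_ne_zero)

theorem eulerD_inftyShift_inv :
    eulerD inftyShift⁻¹ = inftyShift⁻¹ * (8 * (4 * dilate (sigmaSeries 1) - sigmaSeries 1)) := by
  have h := congrArg eulerD inftyShift_mul_inv
  rw [Derivation.leibniz, Derivation.map_one_eq_zero, smul_eq_mul, smul_eq_mul,
    eulerD_inftyShift] at h
  linear_combination inftyShift⁻¹ * h -
    (eulerD inftyShift⁻¹ + inftyShift⁻¹ * 8 * (sigmaSeries 1 - 4 * dilate (sigmaSeries 1))) *
      inftyShift_mul_inv

theorem altNonneg_inftyShift_inv : AltNonneg inftyShift⁻¹ := by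
  refine AltNonneg.of_eulerD_eq_mul (fun n => ?_) ?_ ?_ eulerD_inftyShift_inv
  · have h := divSeries_sign_left 1
    norm_num only at h
    rw [← h, coeff_ofNat_mul, coeff_divSeries]
    rcases eq_or_ne n 0 with rfl | hn
    · simp
    · have := alt_sum_divisors_pos hn one_ne_zero
      linarith
  · simp only [map_sub, coeff_ofNat_mul, coeff_zero_sigmaSeries, coeff_zero_dilate]
    norm_num
  · rw [PowerSeries.coeff_zero_eq_constantCoeff_apply, PowerSeries.constantCoeff_inv,
      ← PowerSeries.coeff_zero_eq_constantCoeff_apply, coeff_zero_inftyShift]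
    norm_num

theorem alt_coeff_eulerD_zeroSeries {n : ℕ} (hn : n ≠ 0) :
    0 < (-1) ^ n * PowerSeries.coeff n (eulerD zeroSeries) := by
  have h := divSeries_sign_left 3
  norm_num only at h
  rw [coeff_eulerD, zeroSeries, ← h, map_add, coeff_ofNat_mul, PowerSeries.coeff_one, if_neg hn,
    coeff_divSeries]
  have h1 := alt_sum_divisors_pos hn three_ne_zero
  have h2 : (0 : ℚ) < n := by exact_mod_cast Nat.pos_of_ne_zero hn
  have := mul_pos h2 h1
  linarith

theorem coeff_inv_pow_mul_eulerD_ne_zero {r : ℕ} (hr : r ≠ 0) :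
    PowerSeries.coeff r (inftyShift⁻¹ ^ r * eulerD zeroSeries) ≠ 0 := by
  suffices h : 0 < (-1) ^ r * PowerSeries.coeff r (inftyShift⁻¹ ^ r * eulerD zeroSeries) from
    fun h0 => by simp [h0] at h
  rw [coeff_mul_alt]
  refine Finset.sum_pos' (fun p _ => mul_nonneg (altNonneg_inftyShift_inv.pow r _) ?_)
    ⟨(0, r), Finset.HasAntidiagonal.mem_antidiagonal.2 (zero_add r), ?_⟩
  · rcases eq_or_ne p.2 0 with h | h
    · simp [h, coeff_eulerD]
    · exact (alt_coeff_eulerD_zeroSeries h).le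
  · refine mul_pos ?_ (alt_coeff_eulerD_zeroSeries hr)
    rw [PowerSeries.coeff_zero_eq_constantCoeff_apply, map_pow, PowerSeries.constantCoeff_inv,
      ← PowerSeries.coeff_zero_eq_constantCoeff_apply, coeff_zero_inftyShift]
    norm_num

theorem coeff_formal_ne_zero {r : ℕ} (hr : 2 ≤ r) :
    PowerSeries.coeff r (gammaSeries * zeroSeries * inftyShift⁻¹ ^ r) ≠ 0 := by
  set W : PowerSeries ℚ := 8 * (4 * dilate (sigmaSeries 1) - sigmaSeries 1) with hW
  have h1 : gammaSeries * zeroSeries * inftyShift⁻¹ ^ r =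
      zeroSeries * inftyShift⁻¹ ^ r - zeroSeries * inftyShift⁻¹ ^ r * W -
        inftyShift⁻¹ ^ r * eulerD zeroSeries := by
    rw [zeroSeries, eulerD_E0, gammaSeries, hW]
    ring
  have h2 : eulerD (zeroSeries * inftyShift⁻¹ ^ r) = inftyShift⁻¹ ^ r * eulerD zeroSeries +
      PowerSeries.C (r : ℚ) * (zeroSeries * inftyShift⁻¹ ^ r * W) := by
    obtain ⟨k, rfl⟩ : ∃ k, r = k + 1 := ⟨r - 1, by omega⟩
    rw [Derivation.leibniz, Derivation.leibniz_pow, eulerD_inftyShift_inv, ← hW]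
    simp only [smul_eq_mul, nsmul_eq_mul, Nat.add_sub_cancel, map_natCast]
    ring
  have h3 := congrArg (PowerSeries.coeff r) h2
  rw [coeff_eulerD, map_add, PowerSeries.coeff_C_mul] at h3
  have h4 := congrArg (PowerSeries.coeff r) h1
  rw [map_sub, map_sub] at h4
  have h5 : (r : ℚ) * PowerSeries.coeff r (gammaSeries * zeroSeries * inftyShift⁻¹ ^ r) =
      (1 - r) * PowerSeries.coeff r (inftyShift⁻¹ ^ r * eulerD zeroSeries) := by
    rw [h4]
    linear_combination h3
  intro h0
  rw [h0, mul_zero, eq_comm, mul_eq_zero] at h5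
  refine h5.elim (fun h => ?_) (coeff_inv_pow_mul_eulerD_ne_zero (by omega))
  have : (2 : ℚ) ≤ r := by exact_mod_cast hr
  linarith

open scoped Topology

/-- The power series `f` converges at `q`, with sum `v`. -/
def HasEval (f : PowerSeries ℂ) (q v : ℂ) : Prop := HasSum (fun n => PowerSeries.coeff n f * q ^ n) v

theorem HasEval.add {f g : PowerSeries ℂ} {q v w : ℂ} (hf : HasEval f q v) (hg : HasEval g q w) :
    HasEval (f + g) q (v + w) := by
  have := HasSum.add hf hg
  simpa only [HasEval, map_add, add_mul] using this

theorem HasEval.sub {f g : PowerSeries ℂ} {q v w : ℂ} (hf : HasEval f q v) (hg : HasEval g q w) :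
    HasEval (f - g) q (v - w) := by
  have := HasSum.sub hf hg
  simpa only [HasEval, map_sub, sub_mul] using this

theorem HasEval.C_mul {f : PowerSeries ℂ} {q v : ℂ} (a : ℂ) (hf : HasEval f q v) :
    HasEval (PowerSeries.C a * f) q (a * v) := by
  have := HasSum.mul_left a hf
  simpa only [HasEval, PowerSeries.coeff_C_mul, mul_assoc] using this

theorem hasEval_one (q : ℂ) : HasEval 1 q 1 := by
  have := hasSum_single (f := fun n => PowerSeries.coeff n (1 : PowerSeries ℂ) * q ^ n) 0
    fun n hn => by simp [PowerSeries.coeff_one, hn]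
  simpa [HasEval] using this

theorem hasEval_zero_right (f : PowerSeries ℂ) : HasEval f 0 (PowerSeries.coeff 0 f) := by
  have := hasSum_single (f := fun n => PowerSeries.coeff n f * (0 : ℂ) ^ n) 0
    fun n hn => by simp [hn]
  simpa [HasEval] using this

theorem HasEval.mul {f g : PowerSeries ℂ} {q v w : ℂ} (hf : HasEval f q v) (hg : HasEval g q w) :
    HasEval (f * g) q (v * w) := by
  have hf' := summable_norm_iff.2 hf.summable
  have hg' := summable_norm_iff.2 hg.summable
  have h1 := (summable_norm_sum_mul_antidiagonal_of_summable_norm hf' hg').of_norm.hasSum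
  rw [← tsum_mul_tsum_eq_tsum_sum_antidiagonal_of_summable_norm hf' hg', hf.tsum_eq,
    hg.tsum_eq] at h1
  refine h1.congr_fun fun n => ?_
  rw [PowerSeries.coeff_mul, Finset.sum_mul]
  refine Finset.sum_congr rfl fun p hp => ?_
  rw [← Finset.HasAntidiagonal.mem_antidiagonal.1 hp, pow_add]
  ring

theorem HasEval.pow {f : PowerSeries ℂ} {q v : ℂ} (hf : HasEval f q v) (r : ℕ) :
    HasEval (f ^ r) q (v ^ r) := by
  induction r with
  | zero => simpa using hasEval_one q
  | succ r ih => simpa only [pow_succ] using ih.mul hf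

theorem HasEval.of_X_mul {f : PowerSeries ℂ} {q v : ℂ} (hq : q ≠ 0)
    (h : HasEval (PowerSeries.X * f) q v) : HasEval f q (v / q) := by
  have h1 := ((hasSum_nat_add_iff' 1).2 h).div_const q
  simp only [Finset.sum_range_one, PowerSeries.coeff_zero_X_mul, zero_mul, sub_zero,
    PowerSeries.coeff_succ_X_mul] at h1
  refine h1.congr_fun fun n => ?_
  rw [pow_succ, ← mul_assoc, mul_div_cancel_right₀ _ hq]

theorem HasEval.hasFPowerSeriesAt {f : PowerSeries ℂ} {F : ℂ → ℂ}
    (h : ∀ᶠ q in 𝓝 0, HasEval f q (F q)) :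
    HasFPowerSeriesAt F (FormalMultilinearSeries.ofScalars ℂ fun n => PowerSeries.coeff n f) 0 := by
  rw [hasFPowerSeriesAt_iff]
  filter_upwards [h] with q hq
  simpa only [FormalMultilinearSeries.coeff_ofScalars, smul_eq_mul, zero_add, mul_comm (q ^ _),
    HasEval] using hq

theorem HasEval.eventually_nhds_update {f : PowerSeries ℂ} {F : ℂ → ℂ}
    (h : ∀ᶠ q in 𝓝[≠] 0, HasEval f q (F q)) :
    ∀ᶠ q in 𝓝 0, HasEval f q (Function.update F 0 (PowerSeries.coeff 0 f) q) := by
  filter_upwards [eventually_nhdsWithin_iff.1 h] with q hq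
  rcases eq_or_ne q 0 with rfl | h0
  · simpa using hasEval_zero_right f
  · rw [Function.update_of_ne h0]
    exact hq h0

theorem HasEval.eventually_ne_zero {f : PowerSeries ℂ} {F : ℂ → ℂ}
    (h : ∀ᶠ q in 𝓝[≠] 0, HasEval f q (F q)) (h0 : PowerSeries.coeff 0 f ≠ 0) :
    ∀ᶠ q in 𝓝[≠] 0, F q ≠ 0 := by
  have h1 := (HasEval.hasFPowerSeriesAt (eventually_nhds_update h)).continuousAt
  have h2 := h1.eventually_ne (y := 0) (by simpa using h0)
  filter_upwards [eventually_nhdsWithin_of_eventually_nhds h2, self_mem_nhdsWithin] with q hq hq0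
  rwa [Function.update_of_ne hq0] at hq

theorem HasEval.eq_of_eventually {f g : PowerSeries ℂ} {F : ℂ → ℂ}
    (hf : ∀ᶠ q in 𝓝[≠] 0, HasEval f q (F q)) (hg : ∀ᶠ q in 𝓝[≠] 0, HasEval g q (F q)) :
    f = g := by
  have h : ∀ᶠ q in 𝓝[≠] 0, HasEval (f - g) q ((0 : ℂ → ℂ) q) := by
    filter_upwards [hf, hg] with q h1 h2
    simpa using h1.sub h2
  have h1 := HasEval.hasFPowerSeriesAt (eventually_nhds_update h)
  have h2 : ∀ᶠ q in 𝓝 0, Function.update (0 : ℂ → ℂ) 0 (PowerSeries.coeff 0 (f - g)) q = 0 := by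
    refine (h1.analyticAt.frequently_eq_iff_eventually_eq analyticAt_const).1
      (Eventually.frequently ?_)
    filter_upwards [self_mem_nhdsWithin] with q hq
    rw [Function.update_of_ne hq]
    rfl
  have h3 := h1.eq_zero_of_eventually h2
  refine sub_eq_zero.1 (PowerSeries.ext fun n => ?_)
  have h4 := congrArg (fun p => FormalMultilinearSeries.coeff p n) h3
  rw [map_zero, ← FormalMultilinearSeries.coeff_ofScalars (𝕜 := ℂ)
    (p := fun n => PowerSeries.coeff n (f - g))]
  exact h4

theorem norm_sum_divisors_le {n : ℕ} {s : Finset ℕ} (hs : s ⊆ n.divisors) {x : ℕ → ℂ}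
    (hx : ∀ d, ‖x d‖ ≤ (d : ℝ) ^ 3) : ‖∑ d ∈ s, x d‖ ≤ (n : ℝ) ^ 4 := by
  have h : ∀ d ∈ s, ‖x d‖ ≤ (n : ℝ) ^ 3 := fun d hd => (hx d).trans (by
    gcongr
    exact Nat.divisor_le (hs hd))
  refine (norm_sum_le_of_le s h).trans ?_
  rw [Finset.sum_const, nsmul_eq_mul, pow_succ' _ 3]
  gcongr
  exact (Finset.card_le_card hs).trans (Nat.card_divisors_le_self n)

theorem hasEval_of_norm_le {a : ℕ → ℂ} (h0 : a 0 = 0) (ha : ∀ n, ‖a n‖ ≤ (n : ℝ) ^ 4) {q : ℂ}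
    (hq : ‖q‖ < 1) : HasEval (PowerSeries.mk a) q (∑' n : ℕ+, a n * q ^ (n : ℕ)) := by
  have hs : Summable fun n => a n * q ^ n := by
    refine Summable.of_norm_bounded (summable_norm_pow_mul_geometric_of_norm_lt_one 4 hq)
      fun n => ?_
    rw [norm_mul, norm_mul]
    gcongr
    simpa using ha n
  have := hs.hasSum
  rw [hs.tsum_eq_zero_add, h0, zero_mul, zero_add,
    ← tsum_pnat_eq_tsum_succ (f := fun n => a n * q ^ n)] at this
  simpa only [HasEval, PowerSeries.coeff_mk] using this

theorem exists_qexp_eq {q : ℂ} (h0 : q ≠ 0) (h1 : ‖q‖ < 1) : ∃ z : ℍ, qexp z = q := by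
  refine ⟨⟨Function.Periodic.invQParam 1 q,
    Function.Periodic.im_invQParam_pos_of_norm_lt_one one_pos h1 h0⟩, ?_⟩
  have := Function.Periodic.qParam_right_inv (h := 1) one_ne_zero h0
  simpa [Function.Periodic.qParam, qexp] using this

theorem coeff_oddDivisorSeries (n : ℕ) :
    PowerSeries.coeff n (sigmaSeries 1 - 2 * dilate (sigmaSeries 1)) = (sigmaOdd n : ℚ) := by
  have h := congrArg (PowerSeries.coeff n) (divSeries_sign_left 1)
  norm_num only [map_sub] at h
  have h4 : PowerSeries.coeff n (4 * dilate (sigmaSeries 1)) =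
    4 * PowerSeries.coeff n (dilate (sigmaSeries 1)) := coeff_ofNat_mul 4 _ n
  have h5 : 2 * PowerSeries.coeff n (sigmaSeries 1 - 2 * dilate (sigmaSeries 1)) =
      ∑ p ∈ n.divisorsAntidiagonal, ((p.1 : ℚ) - (-1) ^ p.1 * (p.1 : ℚ)) := by
    rw [map_sub, coeff_ofNat_mul]
    rw [h4, coeff_divSeries] at h
    simp only [Finset.sum_sub_distrib, pow_one] at h ⊢
    rw [h]
    simp only [sigmaSeries, coeff_divSeries, pow_one]
    ring
  rw [Nat.sum_divisorsAntidiagonal fun a _ => (a : ℚ) - (-1) ^ a * (a : ℚ)] at h5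
  refine mul_left_cancel₀ two_ne_zero (h5.trans ?_)
  rw [sigmaOdd, Nat.cast_sum, Finset.mul_sum, Finset.sum_filter]
  refine Finset.sum_congr rfl fun d _ => ?_
  split_ifs with hd
  · rw [hd.neg_one_pow]; ring
  · rw [(Nat.not_odd_iff_even.1 hd).neg_one_pow]; ring

theorem coeff_altDivisorSeries (n : ℕ) :
    PowerSeries.coeff n (16 * dilate (sigmaSeries 3) - sigmaSeries 3) = (sigma3Alt n : ℚ) := by
  have h := congrArg (PowerSeries.coeff n) (divSeries_sign_left 3)
  norm_num only at h
  rw [← h, coeff_divSeries, Nat.sum_divisorsAntidiagonal fun a _ => (-1 : ℚ) ^ a * (a : ℚ) ^ 3,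
    sigma3Alt]
  push_cast
  rfl

theorem coeff_inftySeries (n : ℕ) : PowerSeries.coeff n inftySeries = sigmaStar3 n := by
  have h := congrArg (PowerSeries.coeff n) (divSeries_sign_right 3)
  rw [coeff_divSeries, map_sub, coeff_ofNat_mul] at h
  have h5 : 2 * PowerSeries.coeff n inftySeries =
      ∑ p ∈ n.divisorsAntidiagonal, ((p.1 : ℚ) ^ 3 - (-1) ^ p.2 * (p.1 : ℚ) ^ 3) := by
    rw [inftySeries, map_sub, Finset.sum_sub_distrib, h]
    simp only [sigmaSeries, coeff_divSeries]
    ring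
  rw [Nat.sum_divisorsAntidiagonal fun a x => (a : ℚ) ^ 3 - (-1) ^ x * (a : ℚ) ^ 3] at h5
  refine mul_left_cancel₀ two_ne_zero (h5.trans ?_)
  rw [sigmaStar3, Nat.cast_sum, Finset.mul_sum, Finset.sum_filter]
  refine Finset.sum_congr rfl fun d _ => ?_
  split_ifs with hd
  · rw [hd.neg_one_pow]; push_cast; ring
  · rw [(Nat.not_odd_iff_even.1 hd).neg_one_pow]; ring

/-- The extension of scalars `ℚ⟦X⟧ → ℂ⟦X⟧`. -/
def toComplex : PowerSeries ℚ →+* PowerSeries ℂ := PowerSeries.map (algebraMap ℚ ℂ)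

theorem coeff_toComplex (f : PowerSeries ℚ) (n : ℕ) :
    PowerSeries.coeff n (toComplex f) = (PowerSeries.coeff n f : ℚ) := by
  simp [toComplex]

theorem hasEval_gammaSeries {z : ℂ} (hz : ‖qexp z‖ < 1) :
    HasEval (toComplex gammaSeries) (qexp z) (Egamma2 z) := by
  have h := hasEval_of_norm_le (a := fun n => (sigmaOdd n : ℂ)) (by simp [sigmaOdd])
    (fun n => by
      rw [sigmaOdd, Nat.cast_sum]
      refine norm_sum_divisors_le (Finset.filter_subset _ _) fun d => ?_
      rw [Complex.norm_natCast]
      exact_mod_cast Nat.le_self_pow three_ne_zero d) hz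
  convert (hasEval_one _).add (h.C_mul 24) using 1
  swap
  · rfl
  rw [gammaSeries, map_add, map_one, map_mul, map_ofNat, map_ofNat]
  congr 2
  ext n
  rw [coeff_toComplex, coeff_oddDivisorSeries, PowerSeries.coeff_mk, Rat.cast_natCast]

theorem hasEval_zeroSeries {z : ℂ} (hz : ‖qexp z‖ < 1) :
    HasEval (toComplex zeroSeries) (qexp z) (E04 z) := by
  have h := hasEval_of_norm_le (a := fun n => (sigma3Alt n : ℂ)) (by simp [sigma3Alt])
    (fun n => by
      rw [sigma3Alt, Int.cast_sum]
      refine norm_sum_divisors_le subset_rfl fun d => ?_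
      simp) hz
  convert (hasEval_one _).add (h.C_mul 16) using 1
  swap
  · rfl
  rw [zeroSeries, map_add, map_one, map_mul, map_ofNat, map_ofNat]
  congr 2
  ext n
  rw [coeff_toComplex, coeff_altDivisorSeries, PowerSeries.coeff_mk, Rat.cast_intCast]

theorem hasEval_inftyShift {z : ℂ} (hz : ‖qexp z‖ < 1) :
    HasEval (toComplex inftyShift) (qexp z) (Einf4 z / qexp z) := by
  have h := hasEval_of_norm_le (a := fun n => (sigmaStar3 n : ℂ)) (by simp [sigmaStar3])
    (fun n => by
      rw [sigmaStar3, Nat.cast_sum]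
      refine norm_sum_divisors_le (Finset.filter_subset _ _) fun d => ?_
      simp) hz
  refine HasEval.of_X_mul (Complex.exp_ne_zero _) ?_
  convert h using 1
  swap
  · rfl
  rw [show PowerSeries.X * toComplex inftyShift = toComplex inftySeries by
    rw [← X_mul_inftyShift, map_mul, toComplex, PowerSeries.map_X]]
  ext n
  rw [coeff_toComplex, coeff_inftySeries, PowerSeries.coeff_mk, Rat.cast_natCast]

/-- A Laurent expansion at `q ≠ 0` with a pole of order at most `r`, multiplied by `q ^ r`. -/
theorem hasEval_of_tsum_zpow_ne_zero {c : ℤ → ℂ} {r : ℕ} (hc : ∀ n : ℤ, n < -r → c n = 0) {q v : ℂ}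
    (hq : q ≠ 0) (hv : v = ∑' n : ℤ, c n * q ^ n) (hv0 : v ≠ 0) :
    HasEval (PowerSeries.mk fun n => c (n - r)) q (q ^ r * v) := by
  have hs : Summable fun n : ℤ => c n * q ^ n := by
    by_contra h
    exact hv0 (hv.trans (tsum_eq_zero_of_not_summable h))
  have h := hs.hasSum
  rw [← hv] at h
  have hinj : Function.Injective fun n : ℕ => (n : ℤ) - r := fun a b hab => by
    simpa using hab
  rw [← hinj.hasSum_iff (fun n hn => ?_)] at h
  · refine (h.mul_left (q ^ r)).congr_fun fun n => ?_
    simp only [PowerSeries.coeff_mk, Function.comp_apply]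
    rw [zpow_sub₀ hq, zpow_natCast, zpow_natCast]
    field_simp
  · rw [hc n, zero_mul]
    by_contra! hn'
    exact hn ⟨(n + r).toNat, by simp only; omega⟩

theorem T2_expansion_eq {c : ℤ → ℂ} {r : ℕ} (hc : ∀ n : ℤ, n < -r → c n = 0)
    (hexp : ∀ z : ℍ, Egamma2 z * E04 z * (Einf4 z ^ r)⁻¹ = ∑' n : ℤ, c n * qexp z ^ n) :
    (PowerSeries.mk fun n => c (n - r)) =
      toComplex (gammaSeries * zeroSeries * inftyShift⁻¹ ^ r) := by
  choose! z hz using fun q : ℂ => fun h : q ≠ 0 ∧ ‖q‖ < 1 => exists_qexp_eq h.1 h.2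
  have hball : ∀ᶠ q : ℂ in 𝓝[≠] 0, q ≠ 0 ∧ ‖q‖ < 1 := by
    filter_upwards [self_mem_nhdsWithin,
      nhdsWithin_le_nhds (Metric.ball_mem_nhds (0 : ℂ) one_pos)] with q h1 h2
    exact ⟨h1, by simpa using h2⟩
  have hG : ∀ᶠ q in 𝓝[≠] 0, HasEval (toComplex gammaSeries) q (Egamma2 (z q)) := by
    filter_upwards [hball] with q h
    have := hasEval_gammaSeries (z := z q) (by rw [hz q h]; exact h.2)
    rwa [hz q h] at this
  have hZ : ∀ᶠ q in 𝓝[≠] 0, HasEval (toComplex zeroSeries) q (E04 (z q)) := by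
    filter_upwards [hball] with q h
    have := hasEval_zeroSeries (z := z q) (by rw [hz q h]; exact h.2)
    rwa [hz q h] at this
  have hU : ∀ᶠ q in 𝓝[≠] 0, HasEval (toComplex inftyShift) q (Einf4 (z q) / q) := by
    filter_upwards [hball] with q h
    have := hasEval_inftyShift (z := z q) (by rw [hz q h]; exact h.2)
    rwa [hz q h] at this
  have key : (PowerSeries.mk fun n => c (n - r)) * toComplex inftyShift ^ r =
      toComplex gammaSeries * toComplex zeroSeries := by
    refine HasEval.eq_of_eventually (F := fun q => Egamma2 (z q) * E04 (z q)) ?_ ?_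
    · have hG0 := HasEval.eventually_ne_zero hG (by
        rw [coeff_toComplex, coeff_zero_gammaSeries]; simp)
      have hZ0 := HasEval.eventually_ne_zero hZ (by
        rw [coeff_toComplex, coeff_zero_zeroSeries]; simp)
      have hU0 := HasEval.eventually_ne_zero hU (by
        rw [coeff_toComplex, coeff_zero_inftyShift]; simp)
      filter_upwards [hball, hG.and hG0, hZ.and hZ0, hU.and hU0] with q hq hG hZ hU
      have hE : Einf4 (z q) ≠ 0 := fun h => hU.2 (by rw [h, zero_div])
      have hv := hexp (z q)
      rw [hz q hq] at hv
      have h := (hasEval_of_tsum_zpow_ne_zero hc hq.1 hv (mul_ne_zero (mul_ne_zero hG.2 hZ.2)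
        (inv_ne_zero (pow_ne_zero r hE)))).mul (hU.1.pow r)
      convert h using 1
      have := hq.1
      rw [div_pow]
      field_simp
    · filter_upwards [hG, hZ] with q hG hZ
      exact hG.mul hZ
  have h1 : toComplex inftyShift ^ r * toComplex inftyShift⁻¹ ^ r = 1 := by
    rw [← mul_pow, ← map_mul, inftyShift_mul_inv, map_one, one_pow]
  rw [map_mul, map_mul, ← key, mul_assoc, map_pow, h1, mul_one]

/-- Proposition 2.10: for positive `h ≡ 0 (mod 4)`, the constant term of the Fourier
expansion of `T_{2,h}` at `∞` is non-zero. -/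
theorem stmt14 (h : ℕ) (hpos : 0 < h) (h4 : h % 4 = 0)
    (c : ℤ → ℂ)
    (hsupp : ∀ n : ℤ, n < -(h / 4 + 1 : ℤ) → c n = 0)
    (hexp : ∀ z : ℍ, T2 h (z : ℂ) = ∑' n : ℤ, c n * qexp (z : ℂ) ^ n) :
    c 0 ≠ 0 := by
  have hr : ((h / 4 + 1 : ℕ) : ℤ) = (h : ℤ) / 4 + 1 := by push_cast; rfl
  have hC := T2_expansion_eq (c := c) (r := h / 4 + 1) (fun n hn => hsupp n (by rwa [hr] at hn))
    fun z => by rw [← hexp z, T2, if_pos h4]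
  have h0 := congrArg (PowerSeries.coeff (h / 4 + 1)) hC
  rw [PowerSeries.coeff_mk, sub_self, coeff_toComplex] at h0
  rw [h0]
  exact_mod_cast coeff_formal_ne_zero (by omega)

end
end

section
/- (i) If h is a positive even integer with h ≡ 8 (mod 12) and r(1,h) = 2^x for some integer x ≥ 1, then c_0[T_h] ≡ 16 (mod 32). (ii) If h ≡ 2 (mod 12) and r(1,h) = 2^x for some integer x ≥ 1, then c_0[T_h] ≡ 8 (mod 32). (iii) If h = 2^x − 6 > 0, then c_0[T_{2,h}] ≡ 8 (mod 16). (iv) If h = 2^x − 4 > 0, then c_0[T_{2,h}] ≡ 16 (mod 32). -/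
open Complex Filter UpperHalfPlane
open scoped MatrixGroups ModularForm Manifold

noncomputable section

/-- `σ_k(n) = Σ_{d∣n} dᵏ`. -/
def sigmak (k n : ℕ) : ℕ := ∑ d ∈ n.divisors, d ^ k

/-- The normalized level one Eisenstein series
`G_k = 1 + α_k Σ σ_{k−1}(n) qⁿ` with `α_k = −2k/B_k` (so `α₄ = 240`, `α₆ = −504`, …,
and `G₀ = 1`). -/
def Gnorm (k : ℕ) (z : ℂ) : ℂ :=
  1 + ((-(2 * (k : ℚ)) / bernoulli k : ℚ) : ℂ) *
    ∑' n : ℕ+, (sigmak (k - 1) n : ℂ) * qexp z ^ (n : ℕ)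

/-- `Δ = q Π_{m≥1} (1−qᵐ)²⁴`. -/
def Deltafun (z : ℂ) : ℂ := qexp z * ∏' m : ℕ+, (1 - qexp z ^ (m : ℕ)) ^ 24

/-- `r(1,h) = ⌊h/12⌋` if `h ≡ 2 (mod 12)` and `⌊h/12⌋ + 1` otherwise. -/
def r1 (h : ℕ) : ℕ := if h % 12 = 2 then h / 12 else h / 12 + 1

/-- Siegel's `T_h = G_{12r−h+2}·Δ^{−r}` with `r = r(1,h)`. -/
def Th (h : ℕ) (z : ℂ) : ℂ := Gnorm (12 * r1 h + 2 - h) z * (Deltafun z ^ r1 h)⁻¹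

section

open Polynomial Topology Asymptotics

/-- `f(q) = p(q) + O(q^N)` as `q → 0`, `q ≠ 0`. -/
def Jet (N : ℕ) (f : ℂ → ℂ) (p : ℤ[X]) : Prop :=
  (fun q : ℂ => f q - aeval q p) =O[𝓝[≠] 0] fun q : ℂ => q ^ N

lemma tendsto_aeval (p : ℤ[X]) :
    Tendsto (fun q : ℂ => aeval q p) (𝓝[≠] 0) (𝓝 (p.coeff 0 : ℂ)) := by
  have h : ContinuousAt (fun q : ℂ => aeval q p) 0 := by
    simpa only [aeval_def, eval₂_eq_eval_map] using (p.map (algebraMap ℤ ℂ)).continuous.continuousAt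
  have h2 := h.tendsto.mono_left (nhdsWithin_le_nhds (s := {0}ᶜ))
  simpa [aeval_def, eval₂_at_zero] using h2

lemma isBigO_pow_of_le {m n : ℕ} (h : m ≤ n) :
    (fun q : ℂ => q ^ n) =O[𝓝[≠] 0] fun q : ℂ => q ^ m := by
  obtain ⟨k, rfl⟩ := Nat.exists_eq_add_of_le h
  have h0 : (fun q : ℂ => q ^ k) =O[𝓝[≠] 0] fun _ => (1 : ℂ) := by
    have : ContinuousAt (fun q : ℂ => q ^ k) 0 := by fun_prop
    exact (this.tendsto.mono_left (nhdsWithin_le_nhds (s := {0}ᶜ))).isBigO_one ℂ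
  simpa [pow_add] using (isBigO_refl (fun q : ℂ => q ^ m) (𝓝[≠] 0)).mul h0

lemma Jet.congr {N : ℕ} {f f' : ℂ → ℂ} {p : ℤ[X]} (h : Jet N f p) (hf : f =ᶠ[𝓝[≠] 0] f') :
    Jet N f' p :=
  IsBigO.congr' h (hf.sub EventuallyEq.rfl) EventuallyEq.rfl

lemma Jet.isBigO_one {N : ℕ} {f : ℂ → ℂ} {p : ℤ[X]} (h : Jet N f p) :
    f =O[𝓝[≠] 0] fun _ => (1 : ℂ) := by
  have h1 : (fun q : ℂ => f q - aeval q p) =O[𝓝[≠] 0] fun _ => (1 : ℂ) := by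
    simpa using IsBigO.trans h (isBigO_pow_of_le (Nat.zero_le N))
  simpa using h1.add ((tendsto_aeval p).isBigO_one ℂ)

lemma Jet.tendsto {N : ℕ} {f : ℂ → ℂ} {p : ℤ[X]} (h : Jet (N + 1) f p) :
    Tendsto f (𝓝[≠] 0) (𝓝 (p.coeff 0 : ℂ)) := by
  have h0 : Tendsto (fun q : ℂ => q ^ (N + 1)) (𝓝[≠] 0) (𝓝 0) := by
    have : ContinuousAt (fun q : ℂ => q ^ (N + 1)) 0 := by fun_prop
    simpa using this.tendsto.mono_left (nhdsWithin_le_nhds (s := {0}ᶜ))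
  simpa using (IsBigO.trans_tendsto h h0).add (tendsto_aeval p)

lemma Jet.of_aeval (N : ℕ) (p : ℤ[X]) : Jet N (fun q => aeval q p) p := by
  simp [Jet, isBigO_zero]

lemma Jet.add {N : ℕ} {f g : ℂ → ℂ} {p r : ℤ[X]} (hf : Jet N f p) (hg : Jet N g r) :
    Jet N (fun q => f q + g q) (p + r) := by
  refine (IsBigO.add hf hg).congr_left fun q => ?_
  simp; ring

lemma Jet.mul {N : ℕ} {f g : ℂ → ℂ} {p r : ℤ[X]} (hf : Jet N f p) (hg : Jet N g r) :
    Jet N (fun q => f q * g q) (p * r) := by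
  have h1 := IsBigO.mul hf hg.isBigO_one
  have h2 := IsBigO.mul ((tendsto_aeval p).isBigO_one ℂ) hg
  have h3 := h1.add (h2.congr_right (g₂ := fun q : ℂ => q ^ N * 1) (by intro; ring_nf))
  unfold Jet
  refine (h3.congr_right (g₂ := fun q : ℂ => q ^ N) (by simp)).congr_left fun q => ?_
  simp; ring

lemma Jet.pow {N : ℕ} {f : ℂ → ℂ} {p : ℤ[X]} (hf : Jet N f p) (k : ℕ) :
    Jet N (fun q => f q ^ k) (p ^ k) := by
  induction k with
  | zero => simpa using Jet.of_aeval N 1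
  | succ k ih => simpa only [pow_succ] using ih.mul hf

lemma X_pow_dvd_of_isBigO {N : ℕ} {d : ℤ[X]}
    (h : (fun q : ℂ => aeval q d) =O[𝓝[≠] 0] fun q : ℂ => q ^ N) : X ^ N ∣ d := by
  induction N with
  | zero => simp
  | succ N ih =>
    obtain ⟨e, rfl⟩ := ih (h.trans (isBigO_pow_of_le N.le_succ))
    have h1 : Jet 1 (fun q : ℂ => aeval q e) 0 := by
      rw [isBigO_iff] at h
      rw [Jet, isBigO_iff]
      obtain ⟨C, hC⟩ := h
      refine ⟨C, ?_⟩
      filter_upwards [hC, self_mem_nhdsWithin] with q hq hq0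
      have : 0 < ‖q‖ := norm_pos_iff.2 hq0
      simp only [map_mul, map_pow, aeval_X, norm_mul, norm_pow, pow_succ] at hq
      simp
      have h3 : 0 < ‖q‖ ^ N := by positivity
      nlinarith
    have h2 := tendsto_nhds_unique h1.tendsto (tendsto_aeval e)
    rw [pow_succ]
    exact mul_dvd_mul_left _ (X_dvd_iff.2 (by simpa using h2.symm))

lemma Jet.unique {N : ℕ} {f : ℂ → ℂ} {p r : ℤ[X]} (hp : Jet N f p) (hr : Jet N f r) :
    X ^ N ∣ p - r := by
  refine X_pow_dvd_of_isBigO ?_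
  refine (IsBigO.sub hr hp).congr_left fun q => ?_
  simp

lemma eventually_norm_lt {r : ℝ} (hr : 0 < r) : ∀ᶠ q : ℂ in 𝓝[≠] 0, ‖q‖ < r := by
  filter_upwards [nhdsWithin_le_nhds (Metric.ball_mem_nhds (0 : ℂ) hr)] with q hq
  simpa using hq

lemma multipliable_one_sub_pow_add (N : ℕ) {q : ℂ} (hq : ‖q‖ < 1) :
    Multipliable fun n : ℕ => 1 - q ^ (n + N + 1) := by
  refine (multipliable_one_add_of_summable (f := fun n : ℕ => -q ^ (n + N + 1)) ?_).congr
    fun n => by ring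
  simpa [add_assoc] using
    (summable_nat_add_iff (N + 1)).mpr (summable_geometric_of_lt_one (norm_nonneg q) hq)

lemma summable_of_norm_le {a : ℕ → ℂ} {q₀ q : ℂ} (h : Summable fun n => a n * q₀ ^ n)
    (hq : ‖q‖ ≤ ‖q₀‖) : Summable fun n => a n * q ^ n := by
  refine Summable.of_norm_bounded h.norm fun n => ?_
  simp only [norm_mul, norm_pow]
  gcongr

lemma jet_tsum {a : ℕ → ℤ} {q₀ : ℂ} (hq₀ : q₀ ≠ 0)
    (h : Summable fun n => (a n : ℂ) * q₀ ^ n) (N : ℕ) :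
    Jet N (fun q => ∑' n, (a n : ℂ) * q ^ n) (∑ n ∈ Finset.range N, C (a n) * X ^ n) := by
  have hr : 0 < ‖q₀‖ := norm_pos_iff.2 hq₀
  have htail : Summable fun n => ‖(a (n + N) : ℂ) * q₀ ^ n‖ := by
    have h1 := ((summable_nat_add_iff N).2 h).norm.mul_left (‖q₀‖ ^ N)⁻¹
    refine h1.congr fun n => ?_
    simp only [norm_mul, norm_pow, pow_add]
    field_simp
  refine IsBigO.of_bound (∑' n, ‖(a (n + N) : ℂ) * q₀ ^ n‖) ?_
  filter_upwards [eventually_norm_lt hr] with q hq'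
  have hq := hq'.le
  rw [← (summable_of_norm_le h hq).sum_add_tsum_nat_add N]
  have h2 : (∑ n ∈ Finset.range N, (a n : ℂ) * q ^ n)
      = aeval q (∑ n ∈ Finset.range N, C (a n) * X ^ n) := by
    simp [map_sum]
  rw [h2, add_sub_cancel_left]
  have h3 : ∑' n, (a (n + N) : ℂ) * q ^ (n + N) = (∑' n, (a (n + N) : ℂ) * q ^ n) * q ^ N := by
    rw [← tsum_mul_right]
    exact tsum_congr fun n => by ring
  rw [h3, norm_mul]
  gcongr
  refine tsum_of_norm_bounded htail.hasSum fun n => ?_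
  simp only [norm_mul, norm_pow]
  gcongr

lemma jet_tprod (N : ℕ) :
    Jet N (fun q => ∏' n : ℕ, (1 - q ^ (n + 1))) (∏ n ∈ Finset.range N, (1 - X ^ (n + 1))) := by
  have htail : (fun q : ℂ => ∏' n : ℕ, (1 - q ^ (n + N + 1)) - 1) =O[𝓝[≠] 0]
      fun q : ℂ => q ^ N := by
    refine IsBigO.of_bound 2 ?_
    filter_upwards [eventually_norm_lt one_half_pos] with q hq
    have hq1 : ‖q‖ < 1 := by linarith
    have hm := multipliable_one_sub_pow_add N hq1
    have hlim := (hm.hasProd.tendsto_prod_nat.sub_const 1).norm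
    refine le_of_tendsto hlim (Eventually.of_forall fun M => ?_)
    have h1 := Finset.norm_prod_one_add_sub_one_le (Finset.range M) fun n => -q ^ (n + N + 1)
    have h2 : ∑ n ∈ Finset.range M, ‖-q ^ (n + N + 1)‖ ≤ ‖q‖ ^ N := by
      have h3 : ∑ n ∈ Finset.range M, ‖q‖ ^ n ≤ 2 := by
        have := (summable_geometric_of_lt_one (norm_nonneg q) hq1).sum_le_tsum (Finset.range M)
          fun _ _ => by positivity
        rw [tsum_geometric_of_lt_one (norm_nonneg q) hq1] at this
        refine this.trans ?_
        rw [inv_le_comm₀ (by linarith) (by norm_num)]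
        linarith
      calc ∑ n ∈ Finset.range M, ‖-q ^ (n + N + 1)‖
          = ‖q‖ ^ N * (‖q‖ * ∑ n ∈ Finset.range M, ‖q‖ ^ n) := by
            rw [Finset.mul_sum, Finset.mul_sum]
            exact Finset.sum_congr rfl fun n _ => by rw [norm_neg, norm_pow]; ring
        _ ≤ ‖q‖ ^ N * (1 / 2 * 2) := by gcongr
        _ = ‖q‖ ^ N := by ring
    have h4 : ‖q‖ ^ N ≤ 1 := pow_le_one₀ (norm_nonneg _) hq1.le
    have h5 := (le_abs_self _).trans
      (Real.abs_exp_sub_one_le (x := ‖q‖ ^ N) (by rwa [abs_of_nonneg (by positivity)]))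
    rw [abs_of_nonneg (by positivity)] at h5
    have h6 := Real.exp_le_exp.2 h2
    simp only [← sub_eq_add_neg] at h1
    rw [norm_pow]
    linarith
  have hjet : Jet N (fun q => ∏' n : ℕ, (1 - q ^ (n + N + 1))) 1 := by simpa [Jet] using htail
  have := (Jet.of_aeval N (∏ n ∈ Finset.range N, (1 - X ^ (n + 1)))).mul hjet
  rw [mul_one] at this
  refine this.congr ?_
  filter_upwards [eventually_norm_lt one_pos] with q hq
  have hm := multipliable_one_sub_pow_add N hq
  rw [← hm.prod_mul_tprod_nat_mul' (f := fun n : ℕ => 1 - q ^ (n + 1))]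
  simp [map_prod]

lemma eventually_exists_qexp : ∀ᶠ q : ℂ in 𝓝[≠] 0, ∃ z : ℍ, qexp (z : ℂ) = q := by
  filter_upwards [eventually_norm_lt one_pos, self_mem_nhdsWithin] with q hq hq0
  refine ⟨⟨_, Function.Periodic.im_invQParam_pos_of_norm_lt_one one_pos hq hq0⟩, ?_⟩
  have := Function.Periodic.qParam_right_inv (h := 1) one_ne_zero hq0
  simpa [Function.Periodic.qParam, qexp] using this

lemma jet_laurent {F : ℂ → ℂ} {c : ℤ → ℤ} {M : ℕ} (hc : ∀ n : ℤ, n < -(M : ℤ) → c n = 0)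
    (hF : ∀ᶠ q in 𝓝[≠] 0, F q ≠ 0)
    (hT : ∀ z : ℍ, F (qexp z) = ∑' n : ℤ, (c n : ℂ) * qexp (z : ℂ) ^ n) (N : ℕ) :
    Jet N (fun q => q ^ M * F q) (∑ n ∈ Finset.range N, C (c (n - M)) * X ^ n) := by
  have key : ∀ᶠ q : ℂ in 𝓝[≠] 0, ∑' n : ℕ, (c (n - M) : ℂ) * q ^ n = q ^ M * F q := by
    filter_upwards [eventually_exists_qexp, self_mem_nhdsWithin] with q hq hq0
    obtain ⟨z, rfl⟩ := hq
    rw [hT, ← tsum_mul_left]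
    have hinj : Function.Injective fun n : ℕ => (n : ℤ) - M := fun a b h => by
      simp only at h; omega
    rw [← hinj.tsum_eq]
    · refine tsum_congr fun n => ?_
      rw [zpow_sub₀ hq0, zpow_natCast, zpow_natCast]
      have : qexp (z : ℂ) ^ M ≠ 0 := pow_ne_zero _ hq0
      field_simp
    · intro n hn
      have : -(M : ℤ) ≤ n := by
        by_contra! h
        simp [hc n h] at hn
      exact ⟨(n + M).toNat, by simp only; omega⟩
  obtain ⟨q₀, h1, h2, h3⟩ :=
    (key.and (hF.and (self_mem_nhdsWithin : ∀ᶠ q : ℂ in 𝓝[≠] 0, q ∈ ({0}ᶜ : Set ℂ)))).exists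
  have h4 : Summable fun n : ℕ => (c (n - M) : ℂ) * q₀ ^ n := by
    by_contra h
    rw [tsum_eq_zero_of_not_summable h] at h1
    exact mul_ne_zero (pow_ne_zero _ h3) h2 h1.symm
  exact (jet_tsum (a := fun n => c (n - M)) h3 h4 N).congr key

lemma dvd_laurent_mul_sub {γ b : ℂ → ℂ} {g B : ℤ[X]} {N R j : ℕ} (hN : N ≠ 0)
    (hγ : Jet N γ g) (hb : Jet N b B) (hg0 : g.coeff 0 = 1) (hB0 : B.coeff 0 = 1)
    {c : ℤ → ℤ} (hc : ∀ n : ℤ, n < -((R + j : ℕ) : ℤ) → c n = 0)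
    (hT : ∀ z : ℍ, γ (qexp z) * ((qexp z * b (qexp z)) ^ R)⁻¹ =
      ∑' n : ℤ, (c n : ℂ) * qexp (z : ℂ) ^ n) :
    X ^ N ∣ (∑ n ∈ Finset.range N, C (c (n - (R + j : ℕ))) * X ^ n) * B ^ R - X ^ j * g := by
  obtain ⟨N, rfl⟩ := Nat.exists_eq_succ_of_ne_zero hN
  have hγ0 : ∀ᶠ q in 𝓝[≠] 0, γ q ≠ 0 := hγ.tendsto.eventually_ne (by simp [hg0])
  have hb0 : ∀ᶠ q in 𝓝[≠] 0, b q ≠ 0 := hb.tendsto.eventually_ne (by simp [hB0])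
  have hF : ∀ᶠ q in 𝓝[≠] 0, γ q * ((q * b q) ^ R)⁻¹ ≠ 0 := by
    filter_upwards [hγ0, hb0, self_mem_nhdsWithin] with q h1 h2 h3
    exact mul_ne_zero h1 (inv_ne_zero (pow_ne_zero _ (mul_ne_zero h3 h2)))
  have h1 := (jet_laurent (F := fun q => γ q * ((q * b q) ^ R)⁻¹) hc hF hT (N + 1)).mul (hb.pow R)
  have h2 := (Jet.of_aeval (N + 1) (X ^ j)).mul hγ
  refine h1.unique (h2.congr ?_)
  filter_upwards [hb0, self_mem_nhdsWithin] with q h2 h3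
  have h3 : q ≠ 0 := h3
  simp only [map_pow, aeval_X, mul_pow, pow_add]
  field_simp

lemma eq_zero_of_laurent {γ b : ℂ → ℂ} {g B : ℤ[X]} {R : ℕ}
    (hγ : Jet 1 γ g) (hb : Jet 1 b B) (hg0 : g.coeff 0 = 1) (hB0 : B.coeff 0 = 1)
    {c : ℤ → ℤ} (hc : ∀ n : ℤ, n < -((R + 1 : ℕ) : ℤ) → c n = 0)
    (hT : ∀ z : ℍ, γ (qexp z) * ((qexp z * b (qexp z)) ^ R)⁻¹ =
      ∑' n : ℤ, (c n : ℂ) * qexp (z : ℂ) ^ n) (n : ℤ) (hn : n < -(R : ℤ)) : c n = 0 := by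
  rcases (show n < -((R + 1 : ℕ) : ℤ) ∨ n = -((R + 1 : ℕ) : ℤ) by push_cast; omega) with h | rfl
  · exact hc n h
  · have h := dvd_laurent_mul_sub one_ne_zero hγ hb hg0 hB0 hc hT
    rw [pow_one, X_dvd_iff] at h
    simpa [mul_coeff_zero, hB0, coeff_zero_eq_eval_zero (B ^ R), ← coeff_zero_eq_eval_zero B] using h

lemma map_pow_eq_expand (F : ℤ[X]) (k : ℕ) :
    (F.map (Int.castRingHom (ZMod 32))) ^ 2 ^ (k + 4) =
      expand _ (2 ^ k) (F.map (Int.castRingHom (ZMod 32))) ^ 16 := by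
  induction k generalizing F with
  | zero => simp
  | succ k ih =>
    have h2 : (2 : ℤ[X]) ∣ F ^ 2 - expand ℤ 2 F := by
      have h := ZMod.expand_card (F.map (Int.castRingHom (ZMod 2)))
      rw [← map_expand, ← Polynomial.map_pow] at h
      have h3 : (F ^ 2 - expand ℤ 2 F).map (Int.castRingHom (ZMod 2)) = 0 := by
        rw [Polynomial.map_sub, h, sub_self]
      rw [show (2 : ℤ[X]) = C 2 from rfl, C_dvd_iff_dvd_coeff]
      intro n
      have h4 := congrArg (fun p => coeff p n) h3
      simp only [coeff_map, coeff_zero] at h4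
      exact (ZMod.intCast_zmod_eq_zero_iff_dvd _ 2).1 (by simpa using h4)
    obtain ⟨W, hW⟩ := dvd_sub_pow_of_dvd_sub (p := 2) (by exact_mod_cast h2) (k + 4)
    have h5 := congrArg (Polynomial.map (Int.castRingHom (ZMod 32))) hW
    have h6 : (2 : (ZMod 32)[X]) ^ (k + 4 + 1) = 0 := by
      have : (32 : (ZMod 32)[X]) = 0 := by
        rw [show (32 : (ZMod 32)[X]) = C 32 from rfl, show (32 : ZMod 32) = 0 from rfl, C_0]
      linear_combination 2 ^ k * this
    simp only [Polynomial.map_sub, Polynomial.map_pow, Polynomial.map_mul, Nat.cast_ofNat,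
      Polynomial.map_ofNat, h6, zero_mul, sub_eq_zero] at h5
    rw [show 2 ^ (k + 1 + 4) = 2 * 2 ^ (k + 4) by ring, pow_mul, h5, ih, map_expand, expand_expand,
      ← pow_succ]

/-- If `F` agrees with `1 + aX + bX²` modulo `X³`, then `F²` agrees with
`1 + 2aX + (2b + a²)X²`. -/
lemma X_pow_three_dvd_sq_sub {A : Type*} [CommRing A] {F : A[X]} {a b : A}
    (h : X ^ 3 ∣ F - (1 + C a * X + C b * X ^ 2)) :
    X ^ 3 ∣ F ^ 2 - (1 + C (2 * a) * X + C (2 * b + a ^ 2) * X ^ 2) := by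
  obtain ⟨W, hW⟩ := h
  rw [sub_eq_iff_eq_add'] at hW
  refine ⟨2 * W * (1 + C a * X + C b * X ^ 2) + X ^ 3 * W ^ 2 + 2 * C a * C b + C b ^ 2 * X, ?_⟩
  simp only [hW, map_add, map_mul, map_pow, map_ofNat]
  ring

/-- A cube congruent to `1 - 3X` and a series congruent to `1 + X` modulo `X³` have the same
sixteenth power modulo `(32, X³)`. -/
lemma expand_pow_sixteen {F : (ZMod 32)[X]} {a : ZMod 32} (ha : a = -3 ∨ a = 1)
    (h : X ^ 3 ∣ F - (1 + C a * X)) {m : ℕ} (hm : 0 < m) :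
    X ^ (2 * m + 1) ∣ expand _ m F ^ 16 - (1 + C 16 * X ^ m + C 24 * X ^ (2 * m)) := by
  have h0 : X ^ 3 ∣ F - (1 + C a * X + C 0 * X ^ 2) := by simpa using h
  have h4 := X_pow_three_dvd_sq_sub (X_pow_three_dvd_sq_sub
    (X_pow_three_dvd_sq_sub (X_pow_three_dvd_sq_sub h0)))
  obtain ⟨W, hW⟩ := h4
  have e1 : 2 * (2 * (2 * (2 * a))) = 16 := by rcases ha with rfl | rfl <;> rfl
  have e2 : 2 * (2 * (2 * (2 * 0 + a ^ 2) + (2 * a) ^ 2) + (2 * (2 * a)) ^ 2)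
      + (2 * (2 * (2 * a))) ^ 2 = 24 := by rcases ha with rfl | rfl <;> rfl
  rw [e1, e2] at hW
  have h5 := congrArg (expand (ZMod 32) m) hW
  simp only [map_sub, map_add, map_mul, map_pow, expand_X, expand_C, map_one] at h5
  rw [← pow_mul, ← pow_mul, ← pow_mul, ← pow_mul, ← pow_mul] at h5
  norm_num at h5
  rw [mul_comm m 2] at h5
  rw [h5]
  exact Dvd.dvd.mul_right (pow_dvd_pow _ (by omega)) _

lemma coeff_modEq_of_dvd {m : ℕ} (hm : 0 < m) {B g g' c : ℤ[X]}
    (hB : X ^ (2 * m + 1) ∣ B.map (Int.castRingHom (ZMod 32)) -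
      (1 + C 16 * X ^ m + C 24 * X ^ (2 * m)))
    (hg : g = 1 + 2 * g') (hg0 : g.coeff 0 = 1) (hc : X ^ (2 * m + 1) ∣ c * B - g) :
    c.coeff (2 * m) ≡ g.coeff (2 * m) + 8 [ZMOD 32] := by
  obtain ⟨W, hW⟩ := hB
  obtain ⟨V, hV⟩ := hc
  have hV := congrArg (Polynomial.map (Int.castRingHom (ZMod 32))) hV
  have h32 : (32 : (ZMod 32)[X]) = 0 := by
    rw [show (32 : (ZMod 32)[X]) = C 32 from rfl, show (32 : ZMod 32) = 0 from rfl, C_0]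
  have hg' := congrArg (Polynomial.map (Int.castRingHom (ZMod 32))) hg
  simp only [Polynomial.map_sub, Polynomial.map_add, Polynomial.map_one, Polynomial.map_pow,
    Polynomial.map_mul, Polynomial.map_ofNat, map_X] at hV hg'
  set b := B.map (Int.castRingHom (ZMod 32))
  set γ := g.map (Int.castRingHom (ZMod 32)) with hγ
  set d := c.map (Int.castRingHom (ZMod 32)) with hd
  set v := V.map (Int.castRingHom (ZMod 32))
  set s := g'.map (Int.castRingHom (ZMod 32))
  simp only [show (C 16 : (ZMod 32)[X]) = 16 from rfl,
    show (C 24 : (ZMod 32)[X]) = 24 from rfl] at hW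
  have key : d = γ + 8 * (γ * X ^ (2 * m)) + 16 * X ^ m + X ^ (2 * m + 1) *
      ((v - d * W) * (1 + 16 * X ^ m + 8 * X ^ (2 * m))) := by
    have hX : (X : (ZMod 32)[X]) ^ (2 * m) = (X ^ m) ^ 2 := by rw [← pow_mul, mul_comm]
    rw [pow_succ X (2 * m), hX] at hV hW ⊢
    set Y := (X : (ZMod 32)[X]) ^ m
    linear_combination (1 + 16 * Y + 8 * Y ^ 2) * hV - d * (1 + 16 * Y + 8 * Y ^ 2) * hW
      + 16 * Y * hg' + (s * Y - d * Y - 9 * d * Y ^ 2 - 16 * d * Y ^ 3 - 6 * d * Y ^ 4) * h32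
  have h1 := congrArg (fun p => coeff p (2 * m)) key
  simp only [coeff_add, show (8 : (ZMod 32)[X]) = C 8 from rfl, coeff_C_mul,
    show (16 : (ZMod 32)[X]) = C 16 from rfl, coeff_mul_X_pow', coeff_X_pow_mul'] at h1
  rw [if_pos le_rfl, if_pos (by omega), coeff_C_of_ne_zero (by omega), if_neg (by omega),
    Nat.sub_self, hγ, hd] at h1
  simp only [coeff_map, hg0] at h1
  refine (ZMod.intCast_eq_intCast_iff _ _ 32).1 ?_
  simpa using h1

/-- The truncation of `Σ q^{n(n+1)/2}` modulo `q¹⁷`. -/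
noncomputable def triangularPoly : ℤ[X] := 1 + X + X ^ 3 + X ^ 6 + X ^ 10 + X ^ 15

lemma dvd_triangularPoly_pow_eight_sub :
    X ^ 17 ∣ triangularPoly ^ 8 -
      (1 + 8 * X + 28 * X ^ 2 + 64 * X ^ 3 + 126 * X ^ 4 + 224 * X ^ 5 + 344 * X ^ 6 + 512 * X
    ^ 7 + 757 * X ^ 8 + 1008 * X ^ 9 + 1332 * X ^ 10 + 1792 * X ^ 11 + 2198 * X ^ 12 + 2752
    * X ^ 13 + 3528 * X ^ 14 + 4096 * X ^ 15 + 4914 * X ^ 16) := by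
  have h2 : X ^ 17 ∣ triangularPoly ^ 2 -
      (1 + 2 * X + X ^ 2 + 2 * X ^ 3 + 2 * X ^ 4 + 3 * X ^ 6 + 2 * X ^ 7 + 2 * X ^ 9 + 2 * X ^
    10 + 2 * X ^ 11 + X ^ 12 + 2 * X ^ 13 + 2 * X ^ 15 + 4 * X ^ 16) :=
    ⟨2 * X + X ^ 3 + 2 * X ^ 4 + 2 * X ^ 8 + X ^ 13, by
      unfold triangularPoly; ring⟩
  have h4 : X ^ 17 ∣ (1 + 2 * X + X ^ 2 + 2 * X ^ 3 + 2 * X ^ 4 + 3 * X ^ 6 + 2 * X ^ 7 + 2 * X ^ 9 + 2 * X ^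
    10 + 2 * X ^ 11 + X ^ 12 + 2 * X ^ 13 + 2 * X ^ 15 + 4 * X ^ 16 : ℤ[X]) ^ 2 -
      (1 + 4 * X + 6 * X ^ 2 + 8 * X ^ 3 + 13 * X ^ 4 + 12 * X ^ 5 + 14 * X ^ 6 + 24 * X ^ 7 +
    18 * X ^ 8 + 20 * X ^ 9 + 32 * X ^ 10 + 24 * X ^ 11 + 31 * X ^ 12 + 40 * X ^ 13 + 30 * X
    ^ 14 + 32 * X ^ 15 + 48 * X ^ 16) :=
    ⟨48 + 34 * X + 48 * X ^ 2 + 36 * X ^ 3 + 24 * X ^ 4 + 48 * X ^ 5 + 28 * X ^ 6 + 17 * X ^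
    7 + 28 * X ^ 8 + 28 * X ^ 9 + 20 * X ^ 10 + 16 * X ^ 11 + 16 * X ^ 12 + 4 * X ^ 13 + 16
    * X ^ 14 + 16 * X ^ 15, by
      ring⟩
  have h8 : X ^ 17 ∣ (1 + 4 * X + 6 * X ^ 2 + 8 * X ^ 3 + 13 * X ^ 4 + 12 * X ^ 5 + 14 * X ^ 6 + 24 * X ^ 7 +
    18 * X ^ 8 + 20 * X ^ 9 + 32 * X ^ 10 + 24 * X ^ 11 + 31 * X ^ 12 + 40 * X ^ 13 + 30 * X
    ^ 14 + 32 * X ^ 15 + 48 * X ^ 16 : ℤ[X]) ^ 2 -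
      (1 + 8 * X + 28 * X ^ 2 + 64 * X ^ 3 + 126 * X ^ 4 + 224 * X ^ 5 + 344 * X ^ 6 + 512 * X
    ^ 7 + 757 * X ^ 8 + 1008 * X ^ 9 + 1332 * X ^ 10 + 1792 * X ^ 11 + 2198 * X ^ 12 + 2752
    * X ^ 13 + 3528 * X ^ 14 + 4096 * X ^ 15 + 4914 * X ^ 16) :=
    ⟨5960 + 6400 * X + 7072 * X ^ 2 + 7876 * X ^ 3 + 7704 * X ^ 4 + 8120 * X ^ 5 + 8704 * X ^
    6 + 7809 * X ^ 7 + 7888 * X ^ 8 + 8068 * X ^ 9 + 6688 * X ^ 10 + 6436 * X ^ 11 + 5760 *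
    X ^ 12 + 3904 * X ^ 13 + 3072 * X ^ 14 + 2304 * X ^ 15, by
      ring⟩
  have h24 := (h2.trans (sub_dvd_pow_sub_pow _ _ 2)).trans (sub_dvd_pow_sub_pow _ _ 2)
  have h44 := h4.trans (sub_dvd_pow_sub_pow _ _ 2)
  have := (h24.add h44).add h8
  rw [sub_add_sub_cancel, sub_add_sub_cancel, ← pow_mul, ← pow_mul] at this
  exact this

lemma sum_pow_le_of_subset_divisors {n : ℕ} {s : Finset ℕ} (hs : s ⊆ n.divisors) (k : ℕ) :
    ∑ d ∈ s, d ^ k ≤ n ^ (k + 1) := by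
  calc ∑ d ∈ s, d ^ k ≤ ∑ d ∈ n.divisors, d ^ k := Finset.sum_le_sum_of_subset hs
    _ ≤ ∑ _d ∈ n.divisors, n ^ k :=
      Finset.sum_le_sum fun d hd => Nat.pow_le_pow_left (Nat.divisor_le hd) k
    _ = n.divisors.card * n ^ k := by simp
    _ ≤ n ^ (k + 1) := by
      rw [pow_succ']
      exact Nat.mul_le_mul_right _ (Nat.card_divisors_le_self n)

lemma abs_sigma3Alt_le (n : ℕ) : |sigma3Alt n| ≤ (n : ℤ) ^ 4 := by
  refine (Finset.abs_sum_le_sum_abs _ _).trans ?_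
  simp only [abs_mul, abs_pow, abs_neg, abs_one, one_pow, one_mul, Nat.abs_cast]
  exact_mod_cast sum_pow_le_of_subset_divisors (n := n) subset_rfl 3

lemma jet_tsum_succ {a : ℕ → ℤ} {K : ℕ} (h : ∀ n, |a n| ≤ (n : ℤ) ^ K) (N : ℕ) :
    Jet N (fun q => ∑' n, (a (n + 1) : ℂ) * q ^ n)
      (∑ n ∈ Finset.range N, C (a (n + 1)) * X ^ n) := by
  refine jet_tsum (a := fun n => a (n + 1)) (q₀ := 1 / 2) (by norm_num) ?_ N
  have h1 : Summable fun n : ℕ => (a n : ℂ) * (1 / 2 : ℂ) ^ n := by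
    refine Summable.of_norm_bounded
      (summable_norm_pow_mul_geometric_of_norm_lt_one K (r := (1 / 2 : ℂ)) (by norm_num))
      fun n => ?_
    simp only [norm_mul]
    gcongr
    rw [norm_pow, norm_natCast, norm_intCast]
    exact_mod_cast h n
  refine (((summable_nat_add_iff 1).2 h1).mul_left 2).congr fun n => ?_
  rw [pow_succ]
  ring

lemma tsum_pnat_mul_pow (a : ℕ → ℂ) (q : ℂ) :
    ∑' n : ℕ+, a n * q ^ (n : ℕ) = q * ∑' n : ℕ, a (n + 1) * q ^ n := by
  rw [tsum_pnat_eq_tsum_succ (f := fun n => a n * q ^ n), ← tsum_mul_left]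
  exact tsum_congr fun n => by ring

/-- The polynomial `Σ_{1 ≤ n ≤ N} a(n) Xⁿ`. -/
def truncPoly (a : ℕ → ℤ) (N : ℕ) : ℤ[X] := X * ∑ n ∈ Finset.range N, C (a (n + 1)) * X ^ n

lemma coeff_zero_truncPoly (a : ℕ → ℤ) (N : ℕ) : (truncPoly a N).coeff 0 = 0 := by
  simp [truncPoly, mul_coeff_zero]

lemma coeff_truncPoly (a : ℕ → ℤ) {n N : ℕ} (hn : n ≠ 0) (h : n ≤ N) :
    (truncPoly a N).coeff n = a n := by
  obtain ⟨n, rfl⟩ := Nat.exists_eq_succ_of_ne_zero hn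
  simp only [truncPoly, Nat.succ_eq_add_one, coeff_X_mul, finsetSum_coeff, coeff_C_mul_X_pow]
  rw [Finset.sum_ite_eq, if_pos (Finset.mem_range.2 (by omega))]

lemma jet_truncPoly {a : ℕ → ℤ} {K : ℕ} (h : ∀ n, |a n| ≤ (n : ℤ) ^ K) (α : ℤ) (N : ℕ) :
    Jet N (fun q => 1 + (α : ℂ) * ∑' n : ℕ+, (a n : ℂ) * q ^ (n : ℕ)) (1 + C α * truncPoly a N) := by
  have h1 := (Jet.of_aeval N X).mul (jet_tsum_succ h N)
  have h2 := (Jet.of_aeval N 1).add ((Jet.of_aeval N (C α)).mul h1)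
  refine h2.congr (Eventually.of_forall fun q => ?_)
  simp [tsum_pnat_mul_pow (fun n => (a n : ℂ))]

lemma X_pow_three_dvd_prod_sub (m : ℕ) :
    (X : ℤ[X]) ^ 3 ∣ ∏ n ∈ Finset.range (m + 2), (1 - X ^ (n + 1)) - (1 - X - X ^ 2) := by
  induction m with
  | zero => exact ⟨1, by simp [Finset.prod_range_succ]; ring⟩
  | succ m ih =>
    obtain ⟨W, hW⟩ := ih
    rw [show m + 1 + 2 = (m + 2) + 1 by ring, Finset.prod_range_succ]
    refine ⟨W - (∏ n ∈ Finset.range (m + 2), (1 - X ^ (n + 1))) * X ^ m, ?_⟩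
    linear_combination hW

lemma dvd_prod_pow_sub (k m : ℕ) :
    X ^ (2 * 2 ^ k + 1) ∣
      (((∏ n ∈ Finset.range (m + 2), (1 - X ^ (n + 1)) : ℤ[X]) ^ 24) ^ 2 ^ (k + 1)).map
        (Int.castRingHom (ZMod 32)) - (1 + C 16 * X ^ 2 ^ k + C 24 * X ^ (2 * 2 ^ k)) := by
  set P : ℤ[X] := ∏ n ∈ Finset.range (m + 2), (1 - X ^ (n + 1))
  obtain ⟨W, hW⟩ : (X : ℤ[X]) ^ 3 ∣ P ^ 3 - (1 + C (-3) * X) := by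
    have h1 := (X_pow_three_dvd_prod_sub m).trans (sub_dvd_pow_sub_pow _ _ 3)
    have h2 : (X : ℤ[X]) ^ 3 ∣ (1 - X - X ^ 2) ^ 3 - (1 + C (-3) * X) :=
      ⟨5 - 3 * X ^ 2 - X ^ 3, by simp only [map_neg, map_ofNat]; ring⟩
    simpa using h1.add h2
  have h3 : X ^ 3 ∣ (P ^ 3).map (Int.castRingHom (ZMod 32)) - (1 + C (-3) * X) := by
    refine ⟨W.map (Int.castRingHom (ZMod 32)), ?_⟩
    have h := congrArg (Polynomial.map (Int.castRingHom (ZMod 32))) hW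
    simp only [Polynomial.map_sub, Polynomial.map_add, Polynomial.map_mul, Polynomial.map_pow,
      Polynomial.map_one, map_X, map_C] at h ⊢
    exact h
  have h4 := expand_pow_sixteen (.inl rfl) h3 (show 0 < 2 ^ k by positivity)
  rwa [← map_pow_eq_expand, ← Polynomial.map_pow, ← pow_mul,
    show 3 * 2 ^ (k + 4) = 24 * 2 ^ (k + 1) by ring, pow_mul] at h4

lemma dvd_truncated_Einf4_sub (N : ℕ) :
    X ^ 17 ∣ ∑ n ∈ Finset.range (17 + N), C (sigmaStar3 (n + 1) : ℤ) * X ^ n -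
      triangularPoly ^ 8 := by
  rw [dvd_sub_comm]
  have h1 : X ^ 17 ∣ ∑ n ∈ Finset.range 17, C (sigmaStar3 (n + 1) : ℤ) * X ^ n -
      ∑ n ∈ Finset.range (17 + N), C (sigmaStar3 (n + 1) : ℤ) * X ^ n := by
    rw [Finset.sum_range_add, sub_add_cancel_left, dvd_neg]
    refine Finset.dvd_sum fun n _ => Dvd.dvd.mul_left (pow_dvd_pow _ (by omega)) _
  have h2 := dvd_triangularPoly_pow_eight_sub.add h1
  convert h2 using 1
  simp only [Finset.sum_range_succ, Finset.sum_range_zero]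
  rw [show sigmaStar3 (0 + 1) = 1 by decide +kernel,
    show sigmaStar3 (1 + 1) = 8 by decide +kernel,
    show sigmaStar3 (2 + 1) = 28 by decide +kernel,
    show sigmaStar3 (3 + 1) = 64 by decide +kernel,
    show sigmaStar3 (4 + 1) = 126 by decide +kernel,
    show sigmaStar3 (5 + 1) = 224 by decide +kernel,
    show sigmaStar3 (6 + 1) = 344 by decide +kernel,
    show sigmaStar3 (7 + 1) = 512 by decide +kernel,
    show sigmaStar3 (8 + 1) = 757 by decide +kernel,
    show sigmaStar3 (9 + 1) = 1008 by decide +kernel,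
    show sigmaStar3 (10 + 1) = 1332 by decide +kernel,
    show sigmaStar3 (11 + 1) = 1792 by decide +kernel,
    show sigmaStar3 (12 + 1) = 2198 by decide +kernel,
    show sigmaStar3 (13 + 1) = 2752 by decide +kernel,
    show sigmaStar3 (14 + 1) = 3528 by decide +kernel,
    show sigmaStar3 (15 + 1) = 4096 by decide +kernel,
    show sigmaStar3 (16 + 1) = 4914 by decide +kernel]
  simp only [Nat.cast_ofNat, Nat.cast_one, map_ofNat, map_one]
  ring

lemma dvd_truncated_Einf4_pow_sub (k N : ℕ) :
    X ^ (2 * 2 ^ k + 1) ∣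
      ((∑ n ∈ Finset.range (17 + N), C (sigmaStar3 (n + 1) : ℤ) * X ^ n) ^ 2 ^ (k + 1)).map
        (Int.castRingHom (ZMod 32)) - (1 + C 16 * X ^ 2 ^ k + C 24 * X ^ (2 * 2 ^ k)) := by
  set U : ℤ[X] := ∑ n ∈ Finset.range (17 + N), C (sigmaStar3 (n + 1) : ℤ) * X ^ n with hU
  have h1 : X ^ 17 ∣ U.map (Int.castRingHom (ZMod 32)) -
      (triangularPoly ^ 8).map (Int.castRingHom (ZMod 32)) := by
    obtain ⟨W, hW⟩ := dvd_truncated_Einf4_sub N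
    refine ⟨W.map (Int.castRingHom (ZMod 32)), ?_⟩
    simpa [hU] using congrArg (Polynomial.map (Int.castRingHom (ZMod 32))) hW
  have h2 : X ^ (2 * 2 ^ k + 1) ∣ U.map (Int.castRingHom (ZMod 32)) ^ 2 ^ (k + 1) -
      (triangularPoly ^ 8).map (Int.castRingHom (ZMod 32)) ^ 2 ^ (k + 1) := by
    rcases le_or_gt (k + 1) 4 with hk | hk
    · refine (pow_dvd_pow X ?_).trans (h1.trans (sub_dvd_pow_sub_pow _ _ _))
      have := Nat.pow_le_pow_right two_pos hk
      rw [pow_succ'] at this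
      omega
    · obtain ⟨j, rfl⟩ : ∃ j, k = j + 3 := ⟨k - 3, by omega⟩
      rw [show j + 3 + 1 = j + 4 by ring, map_pow_eq_expand, map_pow_eq_expand]
      refine dvd_trans ?_ (sub_dvd_pow_sub_pow _ _ 16)
      have h3 := map_dvd (expand (ZMod 32) (2 ^ j)) h1
      rw [map_pow, expand_X, ← pow_mul, map_sub] at h3
      refine (pow_dvd_pow X ?_).trans h3
      have : 0 < 2 ^ j := by positivity
      rw [pow_add]
      omega
  have h3 : X ^ 3 ∣ triangularPoly.map (Int.castRingHom (ZMod 32)) - (1 + C 1 * X) :=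
    ⟨1 + X ^ 3 + X ^ 7 + X ^ 12, by simp [triangularPoly]; ring⟩
  have h4 := expand_pow_sixteen (.inr rfl) h3 (show 0 < 2 ^ k by positivity)
  rw [← map_pow_eq_expand] at h4
  rw [Polynomial.map_pow, ← pow_mul, show 8 * 2 ^ (k + 1) = 2 ^ (k + 4) by ring] at h2
  rw [Polynomial.map_pow]
  simpa using h2.add h4

lemma constant_term_modEq {γ b : ℂ → ℂ} {g g' B : ℤ[X]} {k N : ℕ} (hN : 2 * 2 ^ k < N)
    (hγ : Jet N γ g) (hb : Jet N b B) (hB0 : B.coeff 0 = 1)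
    (hB : X ^ (2 * 2 ^ k + 1) ∣ (B ^ 2 ^ (k + 1)).map (Int.castRingHom (ZMod 32)) -
      (1 + C 16 * X ^ 2 ^ k + C 24 * X ^ (2 * 2 ^ k)))
    (hg : g = 1 + 2 * g') (hg0 : g'.coeff 0 = 0) {c : ℤ → ℤ}
    (hc : ∀ n : ℤ, n < -((2 ^ (k + 1) : ℕ) : ℤ) → c n = 0)
    (hT : ∀ z : ℍ, γ (qexp z) * ((qexp z * b (qexp z)) ^ 2 ^ (k + 1))⁻¹ =
      ∑' n : ℤ, (c n : ℂ) * qexp (z : ℂ) ^ n) :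
    c 0 ≡ 2 * g'.coeff (2 ^ (k + 1)) + 8 [ZMOD 32] := by
  have hcoeff : ∀ n, (2 * g').coeff n = 2 * g'.coeff n := fun n => by
    rw [show (2 : ℤ[X]) = C 2 from rfl, coeff_C_mul]
  have hg1 : g.coeff 0 = 1 := by simp [hg, hg0, hcoeff]
  have h1 := dvd_laurent_mul_sub (j := 0) (by omega) hγ hb hg1 hB0 (by simpa using hc) hT
  rw [pow_zero, one_mul] at h1
  have h2 := coeff_modEq_of_dvd (by positivity) hB hg hg1 ((pow_dvd_pow X hN).trans h1)
  rw [← pow_succ'] at h2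
  have h3 : (∑ n ∈ Finset.range N, C (c (n - (2 ^ (k + 1) + 0 : ℕ))) * X ^ n).coeff (2 ^ (k + 1))
      = c 0 := by
    simp only [finsetSum_coeff, coeff_C_mul_X_pow]
    rw [Finset.sum_ite_eq, if_pos (Finset.mem_range.2 (by rw [pow_succ']; omega))]
    simp
  rw [h3, hg, coeff_add, hcoeff, coeff_one, if_neg (by positivity), zero_add] at h2
  exact h2

lemma sigmaOdd_two_pow (y : ℕ) : sigmaOdd (2 ^ y) = 1 := by
  rw [sigmaOdd, Nat.divisors_prime_pow Nat.prime_two, Finset.sum_filter, Finset.sum_map,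
    Finset.sum_range_succ']
  simpa using fun i _ => (even_two (α := ℕ)).pow_of_ne_zero i.succ_ne_zero

lemma sigma3Alt_two_pow_modEq (y : ℕ) : sigma3Alt (2 ^ y) ≡ 1 [ZMOD 2] := by
  rw [sigma3Alt, Nat.divisors_prime_pow Nat.prime_two, Finset.sum_map, Finset.sum_range_succ']
  have h : (2 : ℤ) ∣ ∑ i ∈ Finset.range y, (-1) ^ 2 ^ (i + 1) * ((2 ^ (i + 1) : ℕ) : ℤ) ^ 3 :=
    Finset.dvd_sum fun i _ => Dvd.dvd.mul_left
      ((by push_cast; exact dvd_pow_self 2 (by omega) : (2 : ℤ) ∣ _).trans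
        (dvd_pow_self _ (by norm_num))) _
  simp only [Function.Embedding.coeFn_mk] at *
  norm_num at *
  unfold Int.ModEq
  omega

lemma sigmak_five_two_pow_modEq (y : ℕ) : (sigmak 5 (2 ^ y) : ℤ) ≡ 1 [ZMOD 4] := by
  rw [sigmak, Nat.divisors_prime_pow Nat.prime_two, Finset.sum_map, Finset.sum_range_succ']
  have h : 4 ∣ ∑ i ∈ Finset.range y, (2 ^ (i + 1)) ^ 5 :=
    Finset.dvd_sum fun i _ => ⟨8 * (2 ^ i) ^ 5, by ring⟩
  simp only [Function.Embedding.coeFn_mk, pow_zero, one_pow]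
  exact (Int.modEq_iff_dvd.2 (by push_cast; simpa using mod_cast h)).symm

lemma jet_Delta (N : ℕ) : Jet N (fun q => ∏' m : ℕ+, (1 - q ^ (m : ℕ)) ^ 24)
    ((∏ n ∈ Finset.range N, (1 - X ^ (n + 1))) ^ 24) := by
  refine ((jet_tprod N).pow 24).congr ?_
  filter_upwards [eventually_norm_lt one_pos] with q hq
  rw [tprod_pnat_eq_tprod_succ (f := fun n => (1 - q ^ n) ^ 24)]
  exact ((multipliable_one_sub_pow_add 0 hq).tprod_pow 24).symm

lemma Th_constant_term_modEq {γ : ℂ → ℂ} {g g' : ℤ[X]} {k N : ℕ} (hN : 2 * 2 ^ k < N)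
    (hγ : Jet N γ g) (hg : g = 1 + 2 * g') (hg0 : g'.coeff 0 = 0) {c : ℤ → ℤ}
    (hc : ∀ n : ℤ, n < -((2 ^ (k + 1) : ℕ) : ℤ) → c n = 0)
    (hT : ∀ z : ℍ, γ (qexp z) * (Deltafun z ^ 2 ^ (k + 1))⁻¹ =
      ∑' n : ℤ, (c n : ℂ) * qexp (z : ℂ) ^ n) :
    c 0 ≡ 2 * g'.coeff (2 ^ (k + 1)) + 8 [ZMOD 32] := by
  have : 0 < 2 ^ k := by positivity
  obtain ⟨m, rfl⟩ : ∃ m, N = m + 2 := ⟨N - 2, by omega⟩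
  refine constant_term_modEq hN hγ (jet_Delta _) ?_ (dvd_prod_pow_sub k m) hg hg0 hc hT
  simp [coeff_zero_eq_eval_zero, eval_prod]

lemma Jet.mono {M N : ℕ} (h : M ≤ N) {f : ℂ → ℂ} {p : ℤ[X]} (hf : Jet N f p) : Jet M f p :=
  hf.trans (isBigO_pow_of_le h)

lemma Einf4_eq (z : ℂ) :
    Einf4 z = qexp z * ∑' n : ℕ, ((sigmaStar3 (n + 1) : ℤ) : ℂ) * qexp z ^ n := by
  simpa [Einf4] using tsum_pnat_mul_pow (fun n => (sigmaStar3 n : ℂ)) (qexp z)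

lemma T2_constant_term_modEq {γ : ℂ → ℂ} {g g' : ℤ[X]} {k N : ℕ} (hN : 2 * 2 ^ k < 17 + N)
    (hγ : Jet (17 + N) γ g) (hg : g = 1 + 2 * g') (hg0 : g'.coeff 0 = 0) {c : ℤ → ℤ}
    (hc : ∀ n : ℤ, n < -((2 ^ (k + 1) + 1 : ℕ) : ℤ) → c n = 0)
    (hT : ∀ z : ℍ, γ (qexp z) * (Einf4 z ^ 2 ^ (k + 1))⁻¹ =
      ∑' n : ℤ, (c n : ℂ) * qexp (z : ℂ) ^ n) :
    c 0 ≡ 2 * g'.coeff (2 ^ (k + 1)) + 8 [ZMOD 32] := by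
  have hb := jet_tsum_succ (a := fun n => (sigmaStar3 n : ℤ)) (K := 4)
    (fun n => by
      rw [Nat.abs_cast]
      exact_mod_cast sum_pow_le_of_subset_divisors (Finset.filter_subset _ _) 3) (17 + N)
  have hB0 : (∑ n ∈ Finset.range (17 + N), C (sigmaStar3 (n + 1) : ℤ) * X ^ n).coeff 0 = 1 := by
    simp only [finsetSum_coeff, coeff_C_mul_X_pow]
    rw [Finset.sum_ite_eq, if_pos (Finset.mem_range.2 (by omega))]
    decide +kernel
  have hg1 : g.coeff 0 = 1 := by
    simp [hg, hg0]
  simp only [Einf4_eq] at hT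
  refine constant_term_modEq hN hγ hb hB0 (dvd_truncated_Einf4_pow_sub k N) hg hg0 ?_ hT
  exact eq_zero_of_laurent (hγ.mono (by omega)) (hb.mono (by omega)) hg1 hB0 hc hT

lemma bernoulli_six : _root_.bernoulli 6 = 1 / 42 := by
  have h5 : bernoulli' 5 = 0 := bernoulli'_eq_zero_of_odd (by decide) (by norm_num)
  rw [bernoulli_eq_bernoulli'_of_ne_one (by norm_num), bernoulli'_def]
  norm_num [Finset.sum_range_succ, h5, Nat.choose]

lemma Gnorm_zero (z : ℂ) : Gnorm 0 z = 1 := by simp [Gnorm]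

lemma Gnorm_six (z : ℂ) :
    Gnorm 6 z = 1 + ((-504 : ℤ) : ℂ) *
      ∑' n : ℕ+, ((sigmak 5 n : ℤ) : ℂ) * qexp z ^ (n : ℕ) := by
  norm_num [Gnorm, bernoulli_six]

lemma Th_zero_constant_term {h k : ℕ} (hh : h % 12 = 2) (hr : r1 h = 2 ^ (k + 1)) {c : ℤ → ℤ}
    (hc : ∀ n : ℤ, n < -(r1 h : ℤ) → c n = 0)
    (hT : ∀ z : ℍ, Th h (z : ℂ) = ∑' n : ℤ, (c n : ℂ) * qexp (z : ℂ) ^ n) :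
    c 0 ≡ 8 [ZMOD 32] := by
  have hw : 12 * r1 h + 2 - h = 0 := by rw [r1, if_pos hh]; omega
  simp only [Th, hw, Gnorm_zero] at hT
  rw [hr] at hc
  simp only [hr] at hT
  simpa using Th_constant_term_modEq (γ := fun _ => 1) (g := 1) (g' := 0) (Nat.lt_succ_self _)
    (by simpa using Jet.of_aeval _ 1) (by simp) (by simp) hc hT

lemma Th_six_constant_term {h k : ℕ} (hh : h % 12 = 8) (hr : r1 h = 2 ^ (k + 1)) {c : ℤ → ℤ}
    (hc : ∀ n : ℤ, n < -(r1 h : ℤ) → c n = 0)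
    (hT : ∀ z : ℍ, Th h (z : ℂ) = ∑' n : ℤ, (c n : ℂ) * qexp (z : ℂ) ^ n) :
    c 0 ≡ 16 [ZMOD 32] := by
  have hw : 12 * r1 h + 2 - h = 6 := by rw [r1, if_neg (by omega)]; omega
  simp only [Th, hw, Gnorm_six] at hT
  rw [hr] at hc
  simp only [hr] at hT
  have hγ := jet_truncPoly (a := fun n => (sigmak 5 n : ℤ)) (K := 6) (fun n => by
    rw [Nat.abs_cast]
    exact_mod_cast sum_pow_le_of_subset_divisors subset_rfl 5) (-504) (2 * 2 ^ k + 1)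
  have key := Th_constant_term_modEq (g' := C (-252) * truncPoly _ _) (Nat.lt_succ_self _) hγ
    (by simp only [map_neg, map_ofNat]; ring) (by simp [coeff_zero_truncPoly]) hc hT
  rw [coeff_C_mul, coeff_truncPoly _ (by positivity) (by rw [pow_succ']; omega)] at key
  have := sigmak_five_two_pow_modEq (k + 1)
  simp only [Int.ModEq] at *
  omega

lemma jet_Egamma2 (N : ℕ) :
    Jet N (fun q => 1 + 24 * ∑' n : ℕ+, (sigmaOdd n : ℂ) * q ^ (n : ℕ))
      (1 + 24 * truncPoly (fun n => sigmaOdd n) N) := by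
  simpa using jet_truncPoly (a := fun n => (sigmaOdd n : ℤ)) (K := 2) (fun n => by
    have := sum_pow_le_of_subset_divisors (Finset.filter_subset (fun d => Odd d) n.divisors) 1
    simp only [pow_one] at this
    rw [Nat.abs_cast]
    exact_mod_cast this) 24 N

lemma jet_E04 (N : ℕ) :
    Jet N (fun q => 1 + 16 * ∑' n : ℕ+, (sigma3Alt n : ℂ) * q ^ (n : ℕ))
      (1 + 16 * truncPoly sigma3Alt N) := by
  simpa using jet_truncPoly abs_sigma3Alt_le 16 N

lemma T2_constant_term_of_mod_four_eq_two {h k : ℕ} (hh : h % 4 = 2) (hr : h / 4 + 2 = 2 ^ (k + 1))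
    {c : ℤ → ℤ} (hc : ∀ n : ℤ, n < -((h / 4 + 2 : ℕ) : ℤ) → c n = 0)
    (hT : ∀ z : ℍ, T2 h (z : ℂ) = ∑' n : ℤ, (c n : ℂ) * qexp (z : ℂ) ^ n) :
    c 0 ≡ 8 [ZMOD 16] := by
  simp only [T2, hh, if_neg (show ¬ (2 = 0) by norm_num), hr, Egamma2, E04] at hT
  rw [hr] at hc
  set A := truncPoly (fun n => (sigmaOdd n : ℤ)) (17 + 2 * 2 ^ k)
  set B := truncPoly sigma3Alt (17 + 2 * 2 ^ k)
  have hA : A.coeff 0 = 0 := coeff_zero_truncPoly _ _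
  have hB : B.coeff 0 = 0 := coeff_zero_truncPoly _ _
  have key := T2_constant_term_modEq (by omega)
    (((jet_Egamma2 (17 + 2 * 2 ^ k)).pow 2).mul (jet_E04 _))
    (g' := C 8 * (3 * A + 36 * A ^ 2 + B * (1 + 24 * A) ^ 2))
    (by simp only [map_ofNat]; ring) (by simp [hA, hB, mul_coeff_zero, pow_two])
    (fun n hn => hc n (by push_cast at hn ⊢; omega)) hT
  rw [coeff_C_mul] at key
  have := key.of_dvd (show (16 : ℤ) ∣ 32 by norm_num)
  simp only [Int.ModEq] at *
  omega

lemma T2_constant_term_of_mod_four_eq_zero {h k : ℕ} (hh : h % 4 = 0) (hr : h / 4 + 1 = 2 ^ (k + 1))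
    {c : ℤ → ℤ} (hc : ∀ n : ℤ, n < -((h / 4 + 2 : ℕ) : ℤ) → c n = 0)
    (hT : ∀ z : ℍ, T2 h (z : ℂ) = ∑' n : ℤ, (c n : ℂ) * qexp (z : ℂ) ^ n) :
    c 0 ≡ 16 [ZMOD 32] := by
  simp only [T2, hh, if_true, hr, Egamma2, E04] at hT
  rw [show h / 4 + 2 = 2 ^ (k + 1) + 1 by omega] at hc
  set A := truncPoly (fun n => (sigmaOdd n : ℤ)) (17 + 2 * 2 ^ k) with hA
  set B := truncPoly sigma3Alt (17 + 2 * 2 ^ k) with hB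
  have hA0 : A.coeff 0 = 0 := coeff_zero_truncPoly _ _
  have hB0 : B.coeff 0 = 0 := coeff_zero_truncPoly _ _
  have key := T2_constant_term_modEq (by omega) ((jet_Egamma2 (17 + 2 * 2 ^ k)).mul (jet_E04 _))
    (g' := C 12 * A + C 8 * B + C 192 * (A * B))
    (by simp only [map_ofNat]; ring) (by simp [hA0, hB0, mul_coeff_zero]) hc hT
  have hle : 2 ^ (k + 1) ≤ 17 + 2 * 2 ^ k := by rw [pow_succ']; omega
  rw [coeff_add, coeff_add, coeff_C_mul, coeff_C_mul, coeff_C_mul, hA, hB,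
    coeff_truncPoly _ (by positivity) hle, coeff_truncPoly _ (by positivity) hle,
    sigmaOdd_two_pow] at key
  have := sigma3Alt_two_pow_modEq (k + 1)
  simp only [Int.ModEq, Nat.cast_one] at *
  omega

lemma three_le_of_lt_two_pow {x : ℕ} (h : 4 < 2 ^ x) : 3 ≤ x := by
  by_contra! hx
  have := Nat.pow_le_pow_right two_pos (Nat.le_of_lt_succ hx)
  omega

end


/-- Theorem 4.3: congruences for the constant terms of `T_h` and `T_{2,h}`.
(i) If `h ≡ 8 (mod 12)` and `r(1,h) = 2^x`, `x ≥ 1`, then `c₀[T_h] ≡ 16 (mod 32)`.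
(ii) If `h ≡ 2 (mod 12)` and `r(1,h) = 2^x`, `x ≥ 1`, then `c₀[T_h] ≡ 8 (mod 32)`.
(iii) If `h = 2^x − 6 > 0`, then `c₀[T_{2,h}] ≡ 8 (mod 16)`.
(iv) If `h = 2^x − 4 > 0`, then `c₀[T_{2,h}] ≡ 16 (mod 32)`. -/
theorem stmt18 :
    (∀ h x : ℕ, 1 ≤ x → h % 12 = 8 → r1 h = 2 ^ x → ∀ c : ℤ → ℤ,
      (∀ n : ℤ, n < -(r1 h : ℤ) → c n = 0) →
      (∀ z : ℍ, Th h (z : ℂ) = ∑' n : ℤ, (c n : ℂ) * qexp (z : ℂ) ^ n) →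
      c 0 ≡ 16 [ZMOD 32]) ∧
    (∀ h x : ℕ, 1 ≤ x → h % 12 = 2 → r1 h = 2 ^ x → ∀ c : ℤ → ℤ,
      (∀ n : ℤ, n < -(r1 h : ℤ) → c n = 0) →
      (∀ z : ℍ, Th h (z : ℂ) = ∑' n : ℤ, (c n : ℂ) * qexp (z : ℂ) ^ n) →
      c 0 ≡ 8 [ZMOD 32]) ∧
    (∀ h x : ℕ, h = 2 ^ x - 6 → 0 < h → ∀ c : ℤ → ℤ,
      (∀ n : ℤ, n < -(h / 4 + 2 : ℤ) → c n = 0) →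
      (∀ z : ℍ, T2 h (z : ℂ) = ∑' n : ℤ, (c n : ℂ) * qexp (z : ℂ) ^ n) →
      c 0 ≡ 8 [ZMOD 16]) ∧
    (∀ h x : ℕ, h = 2 ^ x - 4 → 0 < h → ∀ c : ℤ → ℤ,
      (∀ n : ℤ, n < -(h / 4 + 2 : ℤ) → c n = 0) →
      (∀ z : ℍ, T2 h (z : ℂ) = ∑' n : ℤ, (c n : ℂ) * qexp (z : ℂ) ^ n) →
      c 0 ≡ 16 [ZMOD 32]) := by
  refine ⟨fun h x hx hh hr c hc hT => ?_, fun h x hx hh hr c hc hT => ?_,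
    fun h x hx hh c hc hT => ?_, fun h x hx hh c hc hT => ?_⟩
  · obtain ⟨k, rfl⟩ := Nat.exists_eq_add_of_le' hx
    exact Th_six_constant_term hh hr hc hT
  · obtain ⟨k, rfl⟩ := Nat.exists_eq_add_of_le' hx
    exact Th_zero_constant_term hh hr hc hT
  · obtain ⟨k, rfl⟩ := Nat.exists_eq_add_of_le' (three_le_of_lt_two_pow (x := x) (by omega))
    rw [pow_add] at hx
    have : 0 < 2 ^ k := by positivity
    exact T2_constant_term_of_mod_four_eq_two (k := k) (by omega) (by rw [pow_succ]; omega)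
      (by exact_mod_cast hc) hT
  · obtain ⟨k, rfl⟩ := Nat.exists_eq_add_of_le' (three_le_of_lt_two_pow (x := x) (by omega))
    rw [pow_add] at hx
    have : 0 < 2 ^ k := by positivity
    exact T2_constant_term_of_mod_four_eq_zero (k := k) (by omega) (by rw [pow_succ]; omega)
      (by exact_mod_cast hc) hT

end
end
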